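/- Let D be a disk in ℝ², p ∈ (1,∞), q ∈ [2,∞], and let ∇a ∈ L²(D), ∇b ∈ L^{p,q}(D) (Lorentz space). Let φ solve Δφ = ∇^⊥a·∇b in D with φ = 0 on ∂D. Then ‖∇φ‖_{L^{p,q*}(D)} ≤ C_p ‖∇a‖_{L²(D)} ‖∇b‖_{L^{p,q}(D)}, where 1/q* = 1/2 + 1/q, and C_p is uniformly bounded for p in compact subintervals of (1,∞). -/

import Mathlib

open MeasureTheory Metric Real
open scoped ENNReal NNReal RealInnerProductSpace

noncomputable section

abbrev E2 := EuclideanSpace ℝ (Fin 2)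
abbrev E3 := EuclideanSpace ℝ (Fin 3)

/-- `i`-th partial derivative. -/
def pd {F : Type*} [NormedAddCommGroup F] [NormedSpace ℝ F]
    (i : Fin 2) (f : E2 → F) (x : E2) : F :=
  fderiv ℝ f x (EuclideanSpace.single i 1)

/-- Laplacian on `ℝ²`. -/
def lap {F : Type*} [NormedAddCommGroup F] [NormedSpace ℝ F]
    (f : E2 → F) (x : E2) : F :=
  pd 0 (pd 0 f) x + pd 1 (pd 1 f) x

/-- cross product in `ℝ³`. -/
def cross3 (u v : E3) : E3 :=
  (WithLp.equiv 2 (Fin 3 → ℝ)).symm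
    (crossProduct (WithLp.equiv 2 (Fin 3 → ℝ) u) (WithLp.equiv 2 (Fin 3 → ℝ) v))

/-- weak `L^p` (Marcinkiewicz) quasinorm of `f` on the set `s`. -/
def wnorm (p : ℝ) (f : E2 → ℝ) (s : Set E2) : ℝ≥0∞ :=
  ⨆ t : ℝ≥0, (t : ℝ≥0∞) * (volume {x ∈ s | (t : ℝ) < |f x|}) ^ (1 / p)

/-- Lorentz `L^{p,q}` quasinorm (with `q = ∞` giving weak `L^p`). -/
def lorentzNorm (p : ℝ) (q : ℝ≥0∞) (f : E2 → ℝ) (s : Set E2) : ℝ≥0∞ :=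
  if q = ⊤ then wnorm p f s
  else (∫⁻ t in Set.Ioi (0 : ℝ),
    (ENNReal.ofReal t * (volume {x ∈ s | t < |f x|}) ^ (1 / p)) ^ q.toReal
      / ENNReal.ofReal t) ^ (1 / q.toReal)

/-! ### Decreasing rearrangements -/

/-- The decreasing rearrangement of `f`. -/
def rearr {X : Type*} [MeasurableSpace X] (μ : Measure X) (f : X → ℝ≥0∞) (m : ℝ) : ℝ≥0∞ :=
  sInf {t | μ {x | t < f x} ≤ ENNReal.ofReal m}

section Rearrangement

variable {X : Type*} [MeasurableSpace X] {μ : Measure X} {f g : X → ℝ≥0∞}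

lemma measure_rearr_lt_le (f : X → ℝ≥0∞) (m : ℝ) :
    μ {x | rearr μ f m < f x} ≤ ENNReal.ofReal m := by
  set S := {t | μ {x | t < f x} ≤ ENNReal.ofReal m} with hS
  have hne : S.Nonempty := ⟨⊤, by simp [hS]⟩
  obtain ⟨u, hanti, hlim, hmem⟩ := exists_seq_tendsto_sInf hne (OrderBot.bddBelow S)
  have hset : {x | rearr μ f m < f x} = ⋃ n, {x | u n < f x} := by
    ext x
    simp only [Set.mem_ofPred_eq, Set.mem_iUnion]
    constructor
    · intro h
      exact (hlim.eventually_lt_const h).exists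
    · rintro ⟨n, hn⟩
      exact lt_of_le_of_lt (sInf_le (hmem n)) hn
  rw [hset, Monotone.measure_iUnion]
  · exact iSup_le fun n => hmem n
  · intro i j hij x hx
    exact lt_of_le_of_lt (hanti hij) hx

lemma rearr_le_iff {m : ℝ} {t : ℝ≥0∞} :
    rearr μ f m ≤ t ↔ μ {x | t < f x} ≤ ENNReal.ofReal m := by
  refine ⟨fun h => (measure_mono fun x hx => ?_).trans (measure_rearr_lt_le f m),
    fun h => sInf_le h⟩
  exact lt_of_le_of_lt h hx

lemma lt_rearr_iff {m : ℝ} {t : ℝ≥0∞} :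
    t < rearr μ f m ↔ ENNReal.ofReal m < μ {x | t < f x} := by
  rw [← not_le, rearr_le_iff, not_le]

lemma rearr_mono (h : ∀ x, f x ≤ g x) (m : ℝ) : rearr μ f m ≤ rearr μ g m :=
  rearr_le_iff.2 ((measure_mono fun _ hx => lt_of_lt_of_le hx (h _)).trans
    (measure_rearr_lt_le g m))

lemma antitone_rearr (f : X → ℝ≥0∞) : Antitone (rearr μ f) := fun _ _ h =>
  rearr_le_iff.2 ((measure_rearr_lt_le f _).trans (ENNReal.ofReal_le_ofReal h))

lemma measurable_rearr (f : X → ℝ≥0∞) : Measurable (rearr μ f) :=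
  (antitone_rearr f).measurable

lemma rearr_le_of_or {h : X → ℝ≥0∞} {m n : ℝ} (hm : 0 ≤ m) (hn : 0 ≤ n) {T : ℝ≥0∞}
    (H : ∀ x, f x ≤ rearr μ f m → g x ≤ rearr μ g n → h x ≤ T) :
    rearr μ h (m + n) ≤ T := by
  rw [rearr_le_iff, ENNReal.ofReal_add hm hn]
  refine (measure_mono (t := {x | rearr μ f m < f x} ∪ {x | rearr μ g n < g x}) ?_).trans
    ((measure_union_le _ _).trans
      (add_le_add (measure_rearr_lt_le f m) (measure_rearr_lt_le g n)))
  intro x hx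
  by_contra hcon
  simp only [Set.mem_union, Set.mem_ofPred_eq, not_or, not_lt] at hcon hx
  exact absurd (H x hcon.1 hcon.2) (not_le.2 hx)

lemma rearr_mul_le {m n : ℝ} (hm : 0 ≤ m) (hn : 0 ≤ n) :
    rearr μ (fun x => f x * g x) (m + n) ≤ rearr μ f m * rearr μ g n :=
  rearr_le_of_or hm hn fun _ h₁ h₂ => mul_le_mul' h₁ h₂

lemma rearr_add_le {m n : ℝ} (hm : 0 ≤ m) (hn : 0 ≤ n) :
    rearr μ (fun x => f x + g x) (m + n) ≤ rearr μ f m + rearr μ g n :=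
  rearr_le_of_or hm hn fun _ h₁ h₂ => add_le_add h₁ h₂

lemma rearr_const_mul_le (c : ℝ≥0∞) (m : ℝ) :
    rearr μ (fun x => c * f x) m ≤ c * rearr μ f m := by
  refine rearr_le_iff.2 ((measure_mono fun x hx => ?_).trans (measure_rearr_lt_le f m))
  by_contra hcon
  exact absurd (mul_le_mul_right (not_lt.1 hcon) c) (not_le.2 hx)

end Rearrangement

/-! ### The dilation invariant measure on the half line -/

/-- The measure `dm / m` on `(0, ∞)`. -/
def dilationMeasure : Measure ℝ :=
  (volume.restrict (Set.Ioi 0)).withDensity fun m => (ENNReal.ofReal m)⁻¹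

instance : SFinite dilationMeasure := by unfold dilationMeasure; infer_instance

lemma lintegral_dilationMeasure (F : ℝ → ℝ≥0∞) :
    ∫⁻ m, F m ∂dilationMeasure = ∫⁻ m in Set.Ioi 0, F m / ENNReal.ofReal m := by
  unfold dilationMeasure
  rw [lintegral_withDensity_eq_lintegral_mul_non_measurable _ (by fun_prop)]
  · simp only [Pi.mul_apply, div_eq_mul_inv, mul_comm]
  · filter_upwards [ae_restrict_mem measurableSet_Ioi] with m hm
    simpa using hm

lemma ae_dilationMeasure_pos : ∀ᵐ m ∂dilationMeasure, 0 < m :=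
  (withDensity_absolutelyContinuous _ _).ae_le (ae_restrict_mem measurableSet_Ioi)

lemma lintegral_comp_smul_addHaar {E : Type*} [NormedAddCommGroup E] [NormedSpace ℝ E]
    [MeasurableSpace E] [BorelSpace E] [FiniteDimensional ℝ E] (μ : Measure E)
    [μ.IsAddHaarMeasure] (F : E → ℝ≥0∞) {R : ℝ} (hR : 0 < R) :
    ∫⁻ x, F (R • x) ∂μ = (ENNReal.ofReal R ^ Module.finrank ℝ E)⁻¹ * ∫⁻ x, F x ∂μ := by
  have h := Measure.map_addHaar_smul μ hR.ne'
  rw [abs_of_pos (by positivity), ENNReal.ofReal_inv_of_pos (by positivity),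
    ENNReal.ofReal_pow hR.le] at h
  rw [← smul_eq_mul, ← lintegral_smul_measure, ← h]
  exact ((Homeomorph.smulOfNeZero R hR.ne').toMeasurableEquiv.measurableEmbedding.lintegral_map
    F).symm

lemma lintegral_dilationMeasure_comp_mul (G : ℝ → ℝ≥0∞) {v : ℝ} (hv : 0 < v) :
    ∫⁻ m, G (m * v) ∂dilationMeasure = ∫⁻ m, G m ∂dilationMeasure := by
  rw [lintegral_dilationMeasure, lintegral_dilationMeasure,
    ← lintegral_indicator measurableSet_Ioi, ← lintegral_indicator measurableSet_Ioi]
  set F := (Set.Ioi (0:ℝ)).indicator fun m => G m / ENNReal.ofReal m with hF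
  have h := lintegral_comp_smul_addHaar volume F hv
  have hv0 : ENNReal.ofReal v ≠ 0 := by simpa using hv
  have hvt : ENNReal.ofReal v ≠ ⊤ := ENNReal.ofReal_ne_top
  have hkey : ∀ m, (Set.Ioi (0:ℝ)).indicator (fun m => G (m * v) / ENNReal.ofReal m) m
      = ENNReal.ofReal v * F (v • m) := by
    intro m
    by_cases hm : 0 < m
    · rw [hF, Set.indicator_of_mem (by simpa using hm),
        Set.indicator_of_mem (by simp; positivity), smul_eq_mul, mul_comm m v,
        ENNReal.ofReal_mul hv.le, ENNReal.div_eq_inv_mul, ENNReal.div_eq_inv_mul,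
        ENNReal.mul_inv (Or.inl hv0) (Or.inl hvt), mul_assoc, ← mul_assoc (ENNReal.ofReal v),
        ENNReal.mul_inv_cancel hv0 hvt, one_mul]
    · rw [hF, Set.indicator_of_notMem (by simpa using hm),
        Set.indicator_of_notMem (by
          simp only [smul_eq_mul, Set.mem_Ioi, not_lt] at hm ⊢
          exact mul_nonpos_of_nonneg_of_nonpos hv.le hm), mul_zero]
  rw [lintegral_congr hkey, lintegral_const_mul' _ _ hvt, h]
  simp only [Module.finrank_self, pow_one]
  rw [← mul_assoc, ENNReal.mul_inv_cancel hv0 hvt, one_mul]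

lemma lintegral_dilationMeasure_rpow (L : ℝ≥0∞) {c : ℝ} (hc : 0 < c) :
    ∫⁻ t, {t : ℝ | ENNReal.ofReal t < L}.indicator (fun t => ENNReal.ofReal t ^ c) t
      ∂dilationMeasure = L ^ c / ENNReal.ofReal c := by
  have hfin : ∀ L : ℝ, 0 ≤ L →
      ∫⁻ t, {t : ℝ | ENNReal.ofReal t < ENNReal.ofReal L}.indicator
        (fun t => ENNReal.ofReal t ^ c) t ∂dilationMeasure
        = ENNReal.ofReal L ^ c / ENNReal.ofReal c := by
    intro L hL
    have hint : IntervalIntegrable (fun t : ℝ => t ^ (c - 1)) volume 0 L :=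
      intervalIntegral.intervalIntegrable_rpow' (by linarith)
    have h1 : ∫ t in (0:ℝ)..L, t ^ (c - 1) = L ^ c / c := by
      rw [integral_rpow (Or.inl (by linarith))]
      simp [hc.ne']
    rw [ENNReal.ofReal_rpow_of_nonneg hL hc.le, ← ENNReal.ofReal_div_of_pos hc, ← h1,
      intervalIntegral.integral_of_le hL, ofReal_integral_eq_lintegral_ofReal
        ((intervalIntegrable_iff_integrableOn_Ioc_of_le hL).1 hint)
        (by filter_upwards [ae_restrict_mem measurableSet_Ioc] with t ht
            exact rpow_nonneg ht.1.le _),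
      lintegral_dilationMeasure, ← lintegral_indicator measurableSet_Ioi,
      ← lintegral_indicator measurableSet_Ioc]
    apply lintegral_congr_ae
    filter_upwards [compl_mem_ae_iff.2 (measure_singleton (μ := volume) L)] with t ht
    by_cases h0 : 0 < t
    · rw [Set.indicator_of_mem (by simpa using h0)]
      by_cases hl : t < L
      · rw [Set.indicator_of_mem
            (by simpa using (ENNReal.ofReal_lt_ofReal_iff (h0.trans hl)).2 hl),
          Set.indicator_of_mem (Set.mem_Ioc.2 ⟨h0, hl.le⟩),
          ENNReal.ofReal_rpow_of_pos h0, ← ENNReal.ofReal_div_of_pos h0, rpow_sub_one h0.ne']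
      · rw [Set.indicator_of_notMem, Set.indicator_of_notMem, ENNReal.zero_div]
        · intro h; exact ht (le_antisymm h.2 (not_lt.1 hl))
        · simp only [Set.mem_ofPred_eq, not_lt]
          exact ENNReal.ofReal_le_ofReal (not_lt.1 hl)
    · rw [Set.indicator_of_notMem (by simpa using h0),
        Set.indicator_of_notMem fun h => h0 h.1]
  rcases eq_or_ne L ⊤ with rfl | hL
  · rw [ENNReal.top_rpow_of_pos hc, ENNReal.top_div_of_ne_top ENNReal.ofReal_ne_top]
    refine ENNReal.eq_top_of_forall_nnreal_le fun r => ?_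
    have h := hfin ((r * c) ^ (1 / c)) (by positivity)
    rw [ENNReal.ofReal_rpow_of_nonneg (by positivity) hc.le, ← rpow_mul (by positivity),
      one_div, inv_mul_cancel₀ hc.ne', rpow_one, ← ENNReal.ofReal_div_of_pos hc,
      mul_div_cancel_right₀ _ hc.ne', ENNReal.ofReal_coe_nnreal] at h
    rw [← h]
    refine lintegral_mono fun t => Set.indicator_le_indicator_of_subset ?_ (by simp) t
    intro t ht
    simp
  · have := hfin L.toReal ENNReal.toReal_nonneg
    rwa [ENNReal.ofReal_toReal hL] at this

lemma lintegral_distribution_eq_lintegral_rearr {X : Type*} [MeasurableSpace X] (μ : Measure X)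
    (f : X → ℝ≥0∞) {p q : ℝ} (hp : 0 < p) (hq : 0 < q) :
    ∫⁻ t, (ENNReal.ofReal t * μ {x | ENNReal.ofReal t < f x} ^ (1 / p)) ^ q ∂dilationMeasure
      = (ENNReal.ofReal p)⁻¹ *
        ∫⁻ m, (ENNReal.ofReal m ^ (1 / p) * rearr μ f m) ^ q ∂dilationMeasure := by
  have hqp : 0 < q / p := by positivity
  set K : ℝ → ℝ → ℝ≥0∞ := fun t m => {z : ℝ × ℝ | ENNReal.ofReal z.1 < rearr μ f z.2}.indicator
    (fun z => ENNReal.ofReal z.1 ^ q * ENNReal.ofReal z.2 ^ (q / p)) (t, m) with hK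
  have hKm : Measurable (Function.uncurry K) := by
    refine Measurable.indicator (by fun_prop) (measurableSet_lt (by fun_prop) ?_)
    exact (measurable_rearr f).comp measurable_snd
  have h1 : ∀ t, (ENNReal.ofReal t * μ {x | ENNReal.ofReal t < f x} ^ (1 / p)) ^ q
      = ENNReal.ofReal (q / p) * ∫⁻ m, K t m ∂dilationMeasure := by
    intro t
    have : ∀ m, K t m = ENNReal.ofReal t ^ q *
        {m : ℝ | ENNReal.ofReal m < μ {x | ENNReal.ofReal t < f x}}.indicator
          (fun m => ENNReal.ofReal m ^ (q / p)) m := by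
      intro m
      simp only [hK, Set.indicator_apply, Set.mem_ofPred_eq, lt_rearr_iff]
      split_ifs <;> simp
    simp_rw [this]
    rw [lintegral_const_mul' _ _ (ENNReal.rpow_ne_top_of_nonneg hq.le ENNReal.ofReal_ne_top),
      lintegral_dilationMeasure_rpow _ hqp, ENNReal.mul_rpow_of_nonneg _ _ hq.le,
      ← ENNReal.rpow_mul, one_div_mul_eq_div, mul_left_comm,
      ENNReal.mul_div_cancel (by simpa using hqp) ENNReal.ofReal_ne_top]
  have h2 : ∀ m, ∫⁻ t, K t m ∂dilationMeasure = (ENNReal.ofReal q)⁻¹ *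
      (ENNReal.ofReal m ^ (1 / p) * rearr μ f m) ^ q := by
    intro m
    have : ∀ t, K t m = ENNReal.ofReal m ^ (q / p) *
        {t : ℝ | ENNReal.ofReal t < rearr μ f m}.indicator (fun t => ENNReal.ofReal t ^ q) t := by
      intro t
      simp only [hK, Set.indicator_apply, Set.mem_ofPred_eq]
      split_ifs <;> simp [mul_comm]
    simp_rw [this]
    rw [lintegral_const_mul' _ _ (ENNReal.rpow_ne_top_of_nonneg hqp.le ENNReal.ofReal_ne_top),
      lintegral_dilationMeasure_rpow _ hq, ENNReal.mul_rpow_of_nonneg _ _ hq.le,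
      ← ENNReal.rpow_mul, one_div_mul_eq_div, ENNReal.div_eq_inv_mul, mul_left_comm]
  have hc : ENNReal.ofReal (q / p) * (ENNReal.ofReal q)⁻¹ = (ENNReal.ofReal p)⁻¹ := by
    rw [← ENNReal.ofReal_inv_of_pos hq, ← ENNReal.ofReal_inv_of_pos hp,
      ← ENNReal.ofReal_mul hqp.le]
    congr 1
    field_simp
  rw [lintegral_congr h1, lintegral_const_mul' _ _ ENNReal.ofReal_ne_top,
    lintegral_lintegral_swap hKm.aemeasurable, lintegral_congr h2,
    lintegral_const_mul' _ _ (by simpa using hq), ← mul_assoc, hc]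

/-- The `L^q(dm / m)` norm on the half line, with a true supremum when `q = ∞`. -/
def dilationNorm (q : ℝ≥0∞) (G : ℝ → ℝ≥0∞) : ℝ≥0∞ :=
  if q = ⊤ then ⨆ m ∈ Set.Ioi (0 : ℝ), G m
  else (∫⁻ m, G m ^ q.toReal ∂dilationMeasure) ^ (1 / q.toReal)

lemma dilationNorm_top (G : ℝ → ℝ≥0∞) : dilationNorm ⊤ G = ⨆ m ∈ Set.Ioi (0 : ℝ), G m := by
  simp [dilationNorm]

lemma dilationNorm_of_ne_top {q : ℝ≥0∞} (hq : q ≠ ⊤) (G : ℝ → ℝ≥0∞) :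
    dilationNorm q G = (∫⁻ m, G m ^ q.toReal ∂dilationMeasure) ^ (1 / q.toReal) := by
  simp [dilationNorm, hq]

lemma dilationNorm_mono (q : ℝ≥0∞) {G H : ℝ → ℝ≥0∞} (h : ∀ m, 0 < m → G m ≤ H m) :
    dilationNorm q G ≤ dilationNorm q H := by
  rcases eq_or_ne q ⊤ with rfl | hq
  · rw [dilationNorm_top, dilationNorm_top]
    exact iSup₂_mono fun m hm => h m hm
  · rw [dilationNorm_of_ne_top hq, dilationNorm_of_ne_top hq]
    gcongr 1
    apply lintegral_mono_ae
    filter_upwards [ae_dilationMeasure_pos] with m hm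
    have := h m hm
    gcongr

lemma dilationNorm_const_mul {q : ℝ≥0∞} (hq : 1 ≤ q) {c : ℝ≥0∞} (hc : c ≠ ⊤) (G : ℝ → ℝ≥0∞) :
    dilationNorm q (fun m => c * G m) = c * dilationNorm q G := by
  rcases eq_or_ne q ⊤ with rfl | hq'
  · simp only [dilationNorm_top, ENNReal.mul_iSup]
  · have h0 : 0 < q.toReal := ENNReal.toReal_pos (zero_lt_one.trans_le hq).ne' hq'
    rw [dilationNorm_of_ne_top hq', dilationNorm_of_ne_top hq']
    simp_rw [ENNReal.mul_rpow_of_nonneg _ _ h0.le]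
    rw [lintegral_const_mul' _ _ (ENNReal.rpow_ne_top_of_nonneg h0.le hc),
      ENNReal.mul_rpow_of_nonneg _ _ (by positivity), ← ENNReal.rpow_mul,
      mul_one_div_cancel h0.ne', ENNReal.rpow_one]

lemma dilationNorm_comp_mul (q : ℝ≥0∞) (G : ℝ → ℝ≥0∞) {v : ℝ} (hv : 0 < v) :
    dilationNorm q (fun m => G (m * v)) ≤ dilationNorm q G := by
  rcases eq_or_ne q ⊤ with rfl | hq
  · rw [dilationNorm_top, dilationNorm_top]
    exact iSup₂_le fun m hm => le_iSup₂_of_le (m * v) (mul_pos hm hv) le_rfl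
  · rw [dilationNorm_of_ne_top hq, dilationNorm_of_ne_top hq,
      lintegral_dilationMeasure_comp_mul (fun m => G m ^ q.toReal) hv]

lemma dilationNorm_add_le {q : ℝ≥0∞} (hq : 1 ≤ q) {G H : ℝ → ℝ≥0∞} (hG : Measurable G)
    (hH : Measurable H) :
    dilationNorm q (fun m => G m + H m) ≤ dilationNorm q G + dilationNorm q H := by
  rcases eq_or_ne q ⊤ with rfl | hq'
  · simp only [dilationNorm_top]
    exact iSup₂_le fun m hm => add_le_add (le_iSup₂_of_le m hm le_rfl) (le_iSup₂_of_le m hm le_rfl)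
  · simp only [dilationNorm_of_ne_top hq']
    exact ENNReal.lintegral_Lp_add_le hG.aemeasurable hH.aemeasurable
      (by simpa using (ENNReal.toReal_le_toReal ENNReal.one_ne_top hq').2 hq)

lemma dilationNorm_mul_le {q qs : ℝ≥0∞} (hqs : 1 / qs = 1 / 2 + 1 / q) (hq : 2 ≤ q)
    {G H : ℝ → ℝ≥0∞} (hG : Measurable G) (hH : Measurable H) :
    dilationNorm qs (fun m => G m * H m) ≤ dilationNorm q G * dilationNorm 2 H := by
  rcases eq_or_ne q ⊤ with rfl | hq'
  · have h2 : qs = 2 := by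
      simpa using hqs
    subst h2
    rw [dilationNorm_of_ne_top ENNReal.ofNat_ne_top, dilationNorm_of_ne_top ENNReal.ofNat_ne_top,
      dilationNorm_top]
    set N := ⨆ m ∈ Set.Ioi (0 : ℝ), G m
    have hpos : (0 : ℝ) < (2 : ℝ≥0∞).toReal := by simp
    rw [show N = (N ^ (2 : ℝ≥0∞).toReal) ^ (1 / (2 : ℝ≥0∞).toReal) by
        rw [← ENNReal.rpow_mul, mul_one_div_cancel hpos.ne', ENNReal.rpow_one],
      ← ENNReal.mul_rpow_of_nonneg _ _ (by positivity), ← lintegral_const_mul _ (by fun_prop)]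
    gcongr 1
    apply lintegral_mono_ae
    filter_upwards [ae_dilationMeasure_pos] with m hm
    rw [← ENNReal.mul_rpow_of_nonneg _ _ hpos.le]
    gcongr
    exact le_iSup₂_of_le m hm le_rfl
  · have hq0 : q ≠ 0 := (lt_of_lt_of_le (by simp) hq).ne'
    have hqr : 0 < q.toReal := ENNReal.toReal_pos hq0 hq'
    have hqs0 : qs ≠ 0 := by
      rintro rfl
      simp only [ENNReal.div_zero one_ne_zero] at hqs
      exact absurd hqs.symm (by simp [hq0])
    have hqst : qs ≠ ⊤ := by
      rintro rfl
      rw [ENNReal.div_top] at hqs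
      simpa using (add_eq_zero.1 hqs.symm).1
    have hqsr : 0 < qs.toReal := ENNReal.toReal_pos hqs0 hqst
    have hrel : 1 / qs.toReal = 1 / q.toReal + 1 / (2 : ℝ≥0∞).toReal := by
      have := congrArg ENNReal.toReal hqs
      rw [ENNReal.toReal_add (by simp) (by simp [hq0])] at this
      simp only [one_div, ENNReal.toReal_inv] at this ⊢
      rw [this, add_comm]
    rw [dilationNorm_of_ne_top hqst, dilationNorm_of_ne_top hq',
      dilationNorm_of_ne_top ENNReal.ofNat_ne_top]
    refine ENNReal.lintegral_Lp_mul_le_Lq_mul_Lr hqsr ?_ hrel _ hG.aemeasurable hH.aemeasurable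
    by_contra hcon
    have := one_div_le_one_div_of_le hqr (not_lt.1 hcon)
    rw [hrel] at this
    norm_num at this

/-! ### Hardy operators -/

/-- The integral operator on the half line governing rearrangements of Riesz potentials. -/
def hardyOp (β : ℝ) (F : ℝ → ℝ≥0∞) (m : ℝ) : ℝ≥0∞ :=
  ENNReal.ofReal m ^ (β / 2) *
    ∫⁻ v in Set.Ioi (0 : ℝ), F (m * v) * min 1 (ENNReal.ofReal v ^ (β / 2 - 1))

/-- The norm of `hardyOp β` on functions weighted by `m ^ e`. -/
def hardyConst (e β : ℝ) : ℝ≥0∞ :=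
  ∫⁻ v in Set.Ioi (0 : ℝ), ENNReal.ofReal v ^ (-e) * min 1 (ENNReal.ofReal v ^ (β / 2 - 1))

lemma measurable_hardyOp (β : ℝ) {F : ℝ → ℝ≥0∞} (hF : Measurable F) :
    Measurable (hardyOp β F) := by
  unfold hardyOp
  refine Measurable.mul (by fun_prop) ?_
  exact Measurable.lintegral_prod_right'
    (f := fun z : ℝ × ℝ => F (z.1 * z.2) * min 1 (ENNReal.ofReal z.2 ^ (β / 2 - 1))) (by fun_prop)

lemma rpow_mul_hardyOp (e β : ℝ) (F : ℝ → ℝ≥0∞) {m : ℝ} (hm : 0 < m) :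
    ENNReal.ofReal m ^ (e - β / 2) * hardyOp β F m =
      ∫⁻ v in Set.Ioi (0 : ℝ), (ENNReal.ofReal (m * v) ^ e * F (m * v)) *
        (ENNReal.ofReal v ^ (-e) * min 1 (ENNReal.ofReal v ^ (β / 2 - 1))) := by
  have hm0 : ENNReal.ofReal m ≠ 0 := by simpa using hm
  rw [hardyOp, ← mul_assoc, ← ENNReal.rpow_add _ _ hm0 ENNReal.ofReal_ne_top, sub_add_cancel,
    ← lintegral_const_mul' _ _ (ENNReal.rpow_ne_top_of_ne_zero hm0 ENNReal.ofReal_ne_top)]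
  refine setLIntegral_congr_fun measurableSet_Ioi fun v hv => ?_
  have hv0 : ENNReal.ofReal v ≠ 0 := by simpa using hv
  have h1 : ENNReal.ofReal v ^ e * ENNReal.ofReal v ^ (-e) = 1 := by
    rw [← ENNReal.rpow_add _ _ hv0 ENNReal.ofReal_ne_top, add_neg_cancel, ENNReal.rpow_zero]
  calc ENNReal.ofReal m ^ e * (F (m * v) * min 1 (ENNReal.ofReal v ^ (β / 2 - 1)))
      = (ENNReal.ofReal m ^ e * F (m * v) * min 1 (ENNReal.ofReal v ^ (β / 2 - 1))) * 1 := by ring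
    _ = _ := by
      rw [← h1, ENNReal.ofReal_mul hm.le, ENNReal.mul_rpow_of_ne_top ENNReal.ofReal_ne_top
        ENNReal.ofReal_ne_top]
      ring

lemma dilationNorm_hardyOp_le (e β : ℝ) {q : ℝ≥0∞} (hq : 1 ≤ q) {F : ℝ → ℝ≥0∞}
    (hF : Measurable F) :
    dilationNorm q (fun m => ENNReal.ofReal m ^ (e - β / 2) * hardyOp β F m) ≤
      hardyConst e β * dilationNorm q (fun m => ENNReal.ofReal m ^ e * F m) := by
  set κ : ℝ → ℝ≥0∞ := fun v => ENNReal.ofReal v ^ (-e) * min 1 (ENNReal.ofReal v ^ (β / 2 - 1))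
    with hκ
  have hκm : Measurable κ := by fun_prop
  set G : ℝ → ℝ≥0∞ := fun m => ENNReal.ofReal m ^ e * F m with hG
  have hGm : Measurable G := by fun_prop
  have hK : hardyConst e β = ∫⁻ v in Set.Ioi (0 : ℝ), κ v := rfl
  rcases eq_or_ne q ⊤ with rfl | hq'
  · simp only [dilationNorm_top]
    refine iSup₂_le fun m hm => ?_
    rw [rpow_mul_hardyOp e β F hm, hK, mul_comm (lintegral _ _), ← lintegral_const_mul _ hκm]
    refine setLIntegral_mono' measurableSet_Ioi fun v hv => ?_
    gcongr
    exact le_iSup₂_of_le (f := fun m _ => G m) (m * v)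
      (Set.mem_Ioi.2 (mul_pos hm hv)) le_rfl
  have hq1 : 1 ≤ q.toReal := by
    simpa using (ENNReal.toReal_le_toReal ENNReal.one_ne_top hq').2 hq
  set r := q.toReal
  have hr0 : 0 < r := by linarith
  rw [dilationNorm_of_ne_top hq', dilationNorm_of_ne_top hq']
  set τ := (volume.restrict (Set.Ioi (0 : ℝ))).withDensity κ with hτ
  have hτu : τ Set.univ = hardyConst e β := by
    rw [hτ, withDensity_apply _ MeasurableSet.univ, hK, Measure.restrict_univ]
  have hjensen : ∀ m, 0 < m → (ENNReal.ofReal m ^ (e - β / 2) * hardyOp β F m) ^ r ≤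
      hardyConst e β ^ (r - 1) * ∫⁻ v, G (m * v) ^ r ∂τ := by
    intro m hm
    have hGm' : Measurable fun v => G (m * v) := hGm.comp (measurable_const_mul m)
    have h1 : ENNReal.ofReal m ^ (e - β / 2) * hardyOp β F m = ∫⁻ v, G (m * v) ∂τ := by
      rw [rpow_mul_hardyOp e β F hm, hτ, lintegral_withDensity_eq_lintegral_mul _ hκm hGm']
      simp only [Pi.mul_apply, mul_comm, hG, hκ]
    have h2 := eLpNorm'_le_eLpNorm'_mul_rpow_measure_univ (μ := τ) (f := fun v => G (m * v))
      one_pos hq1 hGm'.aestronglyMeasurable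
    simp only [eLpNorm', enorm_eq_self, ENNReal.rpow_one, div_one, hτu] at h2
    rw [h1]
    calc (∫⁻ v, G (m * v) ∂τ) ^ r
        ≤ ((∫⁻ v, G (m * v) ^ r ∂τ) ^ (1 / r) * hardyConst e β ^ (1 - 1 / r)) ^ r := by
          gcongr
      _ = _ := by
          rw [ENNReal.mul_rpow_of_nonneg _ _ hr0.le, ← ENNReal.rpow_mul, ← ENNReal.rpow_mul,
            one_div_mul_cancel hr0.ne', ENNReal.rpow_one, mul_comm]
          congr 2
          field_simp
  have hfin : ∫⁻ m, (ENNReal.ofReal m ^ (e - β / 2) * hardyOp β F m) ^ r ∂dilationMeasure ≤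
      hardyConst e β ^ r * ∫⁻ m, G m ^ r ∂dilationMeasure := by
    have hmeas : Measurable (Function.uncurry fun m v : ℝ => G (m * v) ^ r) := by
      have : Measurable fun z : ℝ × ℝ => G (z.1 * z.2) ^ r := by fun_prop
      exact this
    have hτpos : ∀ᵐ v ∂τ, 0 < v :=
      (withDensity_absolutelyContinuous _ _).ae_le (ae_restrict_mem measurableSet_Ioi)
    calc _ ≤ ∫⁻ m, hardyConst e β ^ (r - 1) * ∫⁻ v, G (m * v) ^ r ∂τ ∂dilationMeasure := by
          apply lintegral_mono_ae
          filter_upwards [ae_dilationMeasure_pos] with m hm using hjensen m hm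
      _ = hardyConst e β ^ (r - 1) * ∫⁻ v, (∫⁻ m, G (m * v) ^ r ∂dilationMeasure) ∂τ := by
          rw [lintegral_const_mul _ (Measurable.lintegral_prod_right hmeas),
            lintegral_lintegral_swap hmeas.aemeasurable]
      _ = hardyConst e β ^ (r - 1) * ∫⁻ v, (∫⁻ m, G m ^ r ∂dilationMeasure) ∂τ := by
          congr 1
          apply lintegral_congr_ae
          filter_upwards [hτpos] with v hv
          exact lintegral_dilationMeasure_comp_mul (fun m => G m ^ r) hv
      _ = _ := by
          rw [lintegral_const, hτu, mul_comm (lintegral _ _), ← mul_assoc]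
          congr 1
          nth_rewrite 2 [← ENNReal.rpow_one (hardyConst e β)]
          rw [← ENNReal.rpow_add_of_nonneg _ _ (by linarith) zero_le_one, sub_add_cancel]
  calc _ ≤ (hardyConst e β ^ r * ∫⁻ m, G m ^ r ∂dilationMeasure) ^ (1 / r) := by gcongr
    _ = _ := by
      rw [ENNReal.mul_rpow_of_nonneg _ _ (by positivity), ← ENNReal.rpow_mul,
        mul_one_div_cancel hr0.ne', ENNReal.rpow_one]

lemma hardyConst_le {e β : ℝ} (he : e < 1) (hβ : β / 2 < e) :
    hardyConst e β ≤ ENNReal.ofReal (1 / (1 - e) + 1 / (e - β / 2)) := by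
  have h1 : ∫⁻ v in Set.Ioc (0 : ℝ) 1, ENNReal.ofReal (v ^ (-e)) = ENNReal.ofReal (1 / (1 - e)) := by
    rw [← ofReal_integral_eq_lintegral_ofReal, ← intervalIntegral.integral_of_le zero_le_one,
      integral_rpow (Or.inl (by linarith))]
    · have : -e + 1 ≠ 0 := by linarith
      simp [this, sub_eq_add_neg, add_comm]
    · exact (intervalIntegrable_iff_integrableOn_Ioc_of_le zero_le_one).1
        (intervalIntegral.intervalIntegrable_rpow' (by linarith))
    · filter_upwards [ae_restrict_mem measurableSet_Ioc] with t ht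
      exact rpow_nonneg ht.1.le _
  have h2 : ∫⁻ v in Set.Ioi (1 : ℝ), ENNReal.ofReal (v ^ (-e + (β / 2 - 1))) =
      ENNReal.ofReal (1 / (e - β / 2)) := by
    rw [← ofReal_integral_eq_lintegral_ofReal, integral_Ioi_rpow_of_lt (by linarith) one_pos]
    · rw [one_rpow, neg_div, ← div_neg]
      congr 2
      ring
    · exact integrableOn_Ioi_rpow_of_lt (by linarith) one_pos
    · filter_upwards [ae_restrict_mem measurableSet_Ioi] with t ht
      exact rpow_nonneg (zero_le_one.trans (le_of_lt ht)) _
  rw [hardyConst, ← Set.Ioc_union_Ioi_eq_Ioi zero_le_one,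
    ENNReal.ofReal_add (one_div_nonneg.2 (by linarith)) (one_div_nonneg.2 (by linarith)),
    ← h1, ← h2]
  refine (lintegral_union_le _ _ _).trans (add_le_add ?_ ?_)
  · refine setLIntegral_mono' measurableSet_Ioc fun v hv => ?_
    rw [← ENNReal.ofReal_rpow_of_pos hv.1]
    exact mul_le_of_le_one_right' (min_le_left _ _)
  · refine setLIntegral_mono' measurableSet_Ioi fun v hv => ?_
    have hv : 0 < v := zero_lt_one.trans hv
    rw [← ENNReal.ofReal_rpow_of_pos hv,
      ENNReal.rpow_add _ _ (by simpa using hv) ENNReal.ofReal_ne_top]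
    gcongr
    exact min_le_right _ _

/-! ### Riesz potentials in the plane -/

lemma ennreal_rpow_le_rpow_of_nonpos {x y : ℝ≥0∞} {z : ℝ} (hz : z ≤ 0) (h : x ≤ y) :
    y ^ z ≤ x ^ z := by
  have key := ENNReal.inv_le_inv.2 (ENNReal.rpow_le_rpow h (neg_nonneg.2 hz))
  rwa [← ENNReal.rpow_neg, ← ENNReal.rpow_neg, neg_neg] at key

/-- The Riesz potential of order `β` in the plane, without normalizing constant. -/
def rieszPot (β : ℝ) (f : E2 → ℝ≥0∞) (x : E2) : ℝ≥0∞ :=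
  ∫⁻ y, f y * ‖x - y‖ₑ ^ (β - 2)

lemma measurable_rieszPot (β : ℝ) {f : E2 → ℝ≥0∞} (hf : Measurable f) :
    Measurable (rieszPot β f) :=
  Measurable.lintegral_prod_right' (f := fun z : E2 × E2 => f z.2 * ‖z.1 - z.2‖ₑ ^ (β - 2))
    (by fun_prop)

lemma lintegral_ball_enorm_rpow {β : ℝ} (hβ : 0 < β) :
    ∫⁻ y in ball (0 : E2) 1, ‖y‖ₑ ^ (β - 2) = ENNReal.ofReal (2 * π / β) := by
  set f : ℝ → ℝ := (Set.Ioo 0 1).indicator fun t => t ^ (β - 2) with hf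
  have hnn : ∀ t, 0 ≤ f t := fun t => Set.indicator_nonneg (fun t ht => rpow_nonneg ht.1.le _) t
  have hdim : Module.finrank ℝ E2 = 2 := by simp
  have hpow : ∀ y ∈ Set.Ioi (0 : ℝ), y ^ (Module.finrank ℝ E2 - 1) • f y
      = (Set.Ioo (0 : ℝ) 1).indicator (fun t => t ^ (β - 1)) y := by
    intro y hy
    simp only [hdim, hf, Set.indicator_apply, smul_eq_mul]
    split_ifs with h
    · rw [show β - 1 = 1 + (β - 2) by ring, rpow_add hy, rpow_one]
      norm_num
    · simp
  have hint1 : IntegrableOn (fun t : ℝ => t ^ (β - 1)) (Set.Ioo 0 1) :=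
    ((intervalIntegrable_iff_integrableOn_Ioc_of_le zero_le_one).1
      (intervalIntegral.intervalIntegrable_rpow' (by linarith))).mono_set Set.Ioo_subset_Ioc_self
  have hint : Integrable (fun x : E2 => f ‖x‖) := by
    rw [integrable_fun_norm_addHaar volume]
    refine IntegrableOn.congr_fun ?_ (fun y hy => (hpow y hy).symm) measurableSet_Ioi
    exact ((integrable_indicator_iff measurableSet_Ioo).2 hint1).integrableOn
  have hval : ∫ x : E2, f ‖x‖ = 2 * π / β := by
    rw [integral_fun_norm_addHaar volume, setIntegral_congr_fun measurableSet_Ioi hpow,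
      setIntegral_indicator measurableSet_Ioo,
      show Set.Ioi (0 : ℝ) ∩ Set.Ioo 0 1 = Set.Ioo 0 1 from
        Set.inter_eq_right.2 fun t ht => ht.1,
      ← integral_Ioc_eq_integral_Ioo, ← intervalIntegral.integral_of_le zero_le_one,
      integral_rpow (Or.inl (by linarith)), hdim, Measure.real,
      EuclideanSpace.volume_ball_fin_two]
    simp [hβ.ne', pi_nonneg]
    ring
  rw [← hval, ofReal_integral_eq_lintegral_ofReal hint (Filter.Eventually.of_forall fun x => hnn _),
    ← lintegral_indicator measurableSet_ball]
  apply lintegral_congr_ae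
  filter_upwards [compl_mem_ae_iff.2 (measure_singleton (μ := volume) (0 : E2))] with x hx
  have hx0 : 0 < ‖x‖ := norm_pos_iff.2 (by simpa using hx)
  classical
  simp only [hf, Set.indicator_apply, mem_ball_zero_iff, Set.mem_Ioo, hx0, true_and]
  split_ifs
  · rw [← ENNReal.ofReal_rpow_of_pos hx0, ofReal_norm]
  · simp

lemma setLIntegral_enorm_sub_rpow_le {β : ℝ} (hβ : 0 < β) (hβ2 : β < 2) (x : E2) {s : Set E2}
    (hs : MeasurableSet s) :
    ∫⁻ y in s, ‖x - y‖ₑ ^ (β - 2) ≤ ENNReal.ofReal (2 * π / β + 1) * volume s ^ (β / 2) := by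
  rcases eq_or_ne (volume s) 0 with h0 | h0
  · rw [setLIntegral_measure_zero _ _ h0]
    exact zero_le
  rcases eq_or_ne (volume s) ⊤ with ht | ht
  · rw [ht, ENNReal.top_rpow_of_pos (by positivity), ENNReal.mul_top]
    · exact le_top
    · simp only [ne_eq, ENNReal.ofReal_eq_zero, not_le]
      positivity
  set ρ : ℝ := (volume s).toReal ^ (1 / 2 : ℝ) with hρ
  have hv : 0 < (volume s).toReal := ENNReal.toReal_pos h0 ht
  have hρ0 : 0 < ρ := by positivity
  have hρv : ENNReal.ofReal ρ = volume s ^ (1 / 2 : ℝ) := by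
    rw [hρ, ← ENNReal.ofReal_rpow_of_pos hv, ENNReal.ofReal_toReal ht]
  have hρ1 : ENNReal.ofReal ρ ≠ 0 := by simpa using hρ0
  have hρβ : ENNReal.ofReal ρ ^ β = volume s ^ (β / 2) := by
    rw [hρv, ← ENNReal.rpow_mul]
    congr 1
    ring
  have hsplit : ∫⁻ y in s, ‖x - y‖ₑ ^ (β - 2) ≤
      (∫⁻ y in ball x ρ, ‖x - y‖ₑ ^ (β - 2)) + ∫⁻ y in s \ ball x ρ, ‖x - y‖ₑ ^ (β - 2) := by
    refine (lintegral_mono_set ?_).trans (lintegral_union_le _ _ _)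
    intro y hy
    by_cases h : y ∈ ball x ρ
    · exact Or.inl h
    · exact Or.inr ⟨hy, h⟩
  have hfar : ∫⁻ y in s \ ball x ρ, ‖x - y‖ₑ ^ (β - 2) ≤ volume s ^ (β / 2) := by
    calc _ ≤ ∫⁻ _ in s \ ball x ρ, ENNReal.ofReal ρ ^ (β - 2) := by
          refine setLIntegral_mono' (hs.diff measurableSet_ball) fun y hy => ?_
          refine ennreal_rpow_le_rpow_of_nonpos (by linarith) ?_
          rw [← ofReal_norm]
          refine ENNReal.ofReal_le_ofReal ?_
          simpa [dist_eq_norm, norm_sub_rev] using hy.2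
      _ ≤ ENNReal.ofReal ρ ^ (β - 2) * volume s := by
          rw [setLIntegral_const]
          gcongr
          exact Set.sdiff_subset
      _ = _ := by
          have : volume s = ENNReal.ofReal ρ ^ (2 : ℝ) := by
            rw [hρv, ← ENNReal.rpow_mul]
            norm_num
          rw [← hρβ, this, ← ENNReal.rpow_add _ _ hρ1 ENNReal.ofReal_ne_top, sub_add_cancel]
  have hnear : ∫⁻ y in ball x ρ, ‖x - y‖ₑ ^ (β - 2) =
      ENNReal.ofReal (2 * π / β) * volume s ^ (β / 2) := by
    rw [← lintegral_indicator measurableSet_ball, ← lintegral_add_left_eq_self _ x,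
      ← lintegral_ball_enorm_rpow hβ]
    have h := lintegral_comp_smul_addHaar (volume : Measure E2)
      (fun y => (ball x ρ).indicator (fun y => ‖x - y‖ₑ ^ (β - 2)) (x + y)) hρ0
    rw [show Module.finrank ℝ E2 = 2 by simp] at h
    have h' : ∀ y : E2, (ball x ρ).indicator (fun y => ‖x - y‖ₑ ^ (β - 2)) (x + ρ • y)
        = ENNReal.ofReal ρ ^ (β - 2) * (ball (0 : E2) 1).indicator (fun y => ‖y‖ₑ ^ (β - 2)) y := by
      intro y
      have hmem : x + ρ • y ∈ ball x ρ ↔ y ∈ ball (0 : E2) 1 := by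
        simp [norm_smul, abs_of_pos hρ0, hρ0]
      classical
      simp only [Set.indicator_apply, hmem]
      split_ifs
      · rw [sub_add_cancel_left, enorm_neg, enorm_smul,
          ENNReal.mul_rpow_of_ne_top enorm_ne_top enorm_ne_top, Real.enorm_of_nonneg hρ0.le]
      · simp
    rw [lintegral_congr h', lintegral_const_mul' _ _
      (ENNReal.rpow_ne_top_of_ne_zero hρ1 ENNReal.ofReal_ne_top),
      lintegral_indicator measurableSet_ball] at h
    rw [← hρβ, mul_comm]
    have hρ2 : ENNReal.ofReal ρ ^ 2 ≠ 0 := pow_ne_zero _ hρ1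
    have hρ2t : ENNReal.ofReal ρ ^ 2 ≠ ⊤ := ENNReal.pow_ne_top ENNReal.ofReal_ne_top
    rw [show ENNReal.ofReal ρ ^ β = ENNReal.ofReal ρ ^ 2 * ENNReal.ofReal ρ ^ (β - 2) by
      rw [← ENNReal.rpow_two, ← ENNReal.rpow_add _ _ hρ1 ENNReal.ofReal_ne_top,
        add_sub_cancel], mul_assoc, h, ← mul_assoc, ENNReal.mul_inv_cancel hρ2 hρ2t, one_mul]
  calc _ ≤ _ := hsplit
    _ ≤ ENNReal.ofReal (2 * π / β) * volume s ^ (β / 2) + volume s ^ (β / 2) := by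
        rw [hnear]
        gcongr
    _ = _ := by
        rw [ENNReal.ofReal_add (by positivity) zero_le_one, ENNReal.ofReal_one, add_mul, one_mul]

lemma hardyOp_eq (β : ℝ) (F : ℝ → ℝ≥0∞) {m : ℝ} (hm : 0 < m) :
    hardyOp β F m = ∫⁻ u, (ENNReal.ofReal u * min (ENNReal.ofReal m ^ (β / 2 - 1))
      (ENNReal.ofReal u ^ (β / 2 - 1))) * F u ∂dilationMeasure := by
  have hm0 : ENNReal.ofReal m ≠ 0 := by simpa using hm
  rw [← lintegral_dilationMeasure_comp_mul _ hm, lintegral_dilationMeasure, hardyOp,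
    ← lintegral_const_mul' _ _ (ENNReal.rpow_ne_top_of_ne_zero hm0 ENNReal.ofReal_ne_top)]
  refine setLIntegral_congr_fun measurableSet_Ioi fun v hv => ?_
  have hv : 0 < v := hv
  have hv0 : ENNReal.ofReal v ≠ 0 := by simpa using hv
  have hmin : min (ENNReal.ofReal m ^ (β / 2 - 1)) (ENNReal.ofReal (v * m) ^ (β / 2 - 1)) =
      ENNReal.ofReal m ^ (β / 2 - 1) * min 1 (ENNReal.ofReal v ^ (β / 2 - 1)) := by
    rw [mul_min, mul_one, ENNReal.ofReal_mul hv.le,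
      ENNReal.mul_rpow_of_ne_top ENNReal.ofReal_ne_top ENNReal.ofReal_ne_top,
      mul_comm (ENNReal.ofReal v ^ _)]
  simp only [hmin, ENNReal.div_eq_inv_mul]
  rw [show ENNReal.ofReal m ^ (β / 2) = ENNReal.ofReal m * ENNReal.ofReal m ^ (β / 2 - 1) by
      nth_rewrite 2 [← ENNReal.rpow_one (ENNReal.ofReal m)]
      rw [← ENNReal.rpow_add _ _ hm0 ENNReal.ofReal_ne_top, add_sub_cancel],
    mul_comm v m, ENNReal.ofReal_mul hm.le]
  calc _ = ((ENNReal.ofReal v)⁻¹ * ENNReal.ofReal v) * (ENNReal.ofReal m *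
        ENNReal.ofReal m ^ (β / 2 - 1) *
          (F (m * v) * min 1 (ENNReal.ofReal v ^ (β / 2 - 1)))) := by
        rw [ENNReal.inv_mul_cancel hv0 ENNReal.ofReal_ne_top, one_mul]
    _ = _ := by ring

lemma min_mul_rpow_le_lintegral {γ : ℝ} (hγ : 0 < γ) (hγ1 : γ < 1) {m : ℝ} (hm : 0 < m)
    {A E : ℝ≥0∞} (hA : ENNReal.ofReal m ≤ A) (hAt : A ≠ ⊤) :
    min (E * A ^ γ) (A * E ^ γ) ≤ A * ∫⁻ u, {u : ℝ | ENNReal.ofReal u < E}.indicator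
      (fun u => ENNReal.ofReal u * min (ENNReal.ofReal m ^ (γ - 1)) (ENNReal.ofReal u ^ (γ - 1))) u
        ∂dilationMeasure := by
  have hA0 : A ≠ 0 := ((ENNReal.ofReal_pos.2 hm).trans_le hA).ne'
  rcases eq_or_ne E ⊤ with rfl | hE
  · have hle : ∀ u : ℝ, 0 < u → ENNReal.ofReal u ^ γ ≤
        {u : ℝ | ENNReal.ofReal u < ENNReal.ofReal m}.indicator (fun u => ENNReal.ofReal u ^ γ) u +
        ENNReal.ofReal u * min (ENNReal.ofReal m ^ (γ - 1)) (ENNReal.ofReal u ^ (γ - 1)) := by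
      intro u hu
      by_cases h : ENNReal.ofReal u < ENNReal.ofReal m
      · rw [Set.indicator_of_mem (by simpa using h)]
        exact le_self_add
      · rw [min_eq_right (ennreal_rpow_le_rpow_of_nonpos (by linarith) (not_lt.1 h))]
        have h1 := ENNReal.rpow_one (ENNReal.ofReal u)
        conv_rhs => enter [2, 1]; rw [← h1]
        rw [← ENNReal.rpow_add _ _ (by simpa using hu) ENNReal.ofReal_ne_top, add_sub_cancel]
        exact le_add_self
    have hinf := lintegral_dilationMeasure_rpow ⊤ hγ
    rw [ENNReal.top_rpow_of_pos hγ, ENNReal.top_div_of_ne_top ENNReal.ofReal_ne_top] at hinf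
    have huniv : {u : ℝ | ENNReal.ofReal u < ⊤} = Set.univ := by
      ext; simp
    rw [huniv, Set.indicator_univ] at hinf
    rw [huniv, Set.indicator_univ]
    have h2 := (lintegral_mono_ae (ae_dilationMeasure_pos.mono hle))
    rw [hinf, lintegral_add_right _ (by fun_prop), lintegral_dilationMeasure_rpow _ hγ,
      top_le_iff, ENNReal.add_eq_top] at h2
    rcases h2 with h2 | h2
    · exact absurd h2 (ENNReal.div_ne_top
        (ENNReal.rpow_ne_top_of_nonneg hγ.le ENNReal.ofReal_ne_top) (by simpa using hγ))
    · rw [h2, ENNReal.mul_top hA0]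
      exact le_top
  rcases eq_or_ne E 0 with rfl | hE0
  · simp
  have hlow : E * min (ENNReal.ofReal m ^ (γ - 1)) (E ^ (γ - 1)) ≤
      ∫⁻ u, {u : ℝ | ENNReal.ofReal u < E}.indicator (fun u => ENNReal.ofReal u *
        min (ENNReal.ofReal m ^ (γ - 1)) (ENNReal.ofReal u ^ (γ - 1))) u ∂dilationMeasure := by
    have h1 := lintegral_dilationMeasure_rpow E one_pos
    simp only [ENNReal.rpow_one, ENNReal.ofReal_one, div_one] at h1
    nth_rewrite 1 [← h1]
    rw [← lintegral_mul_const' _ _ (ne_top_of_le_ne_top (ENNReal.rpow_ne_top_of_ne_zero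
      hE0 hE) (min_le_right _ _))]
    refine lintegral_mono fun u => ?_
    simp only [Set.indicator_apply, Set.mem_ofPred_eq]
    split_ifs with h
    · refine mul_le_mul_right (min_le_min_left _ ?_) _
      exact ennreal_rpow_le_rpow_of_nonpos (by linarith) h.le
    · simp
  refine le_trans ?_ (mul_le_mul_right hlow A)
  have hp : ∀ x : ℝ≥0∞, x ≠ 0 → x ≠ ⊤ → x ^ γ = x * x ^ (γ - 1) := by
    intro x h0 ht
    nth_rewrite 2 [← ENNReal.rpow_one x]
    rw [← ENNReal.rpow_add _ _ h0 ht, add_sub_cancel]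
  rw [hp A hA0 hAt, hp E hE0 hE, mul_min, mul_min, ← mul_assoc, mul_comm E A, ← mul_assoc, ← mul_assoc]
  refine min_le_min_right _ (mul_le_mul_right ?_ _)
  exact ennreal_rpow_le_rpow_of_nonpos (by linarith) hA

lemma rearr_rieszPot_le {β : ℝ} (hβ : 0 < β) (hβ2 : β < 2) {f : E2 → ℝ≥0∞} (hf : Measurable f)
    {m : ℝ} (hm : 0 < m) :
    rearr volume (rieszPot β f) m ≤
      ENNReal.ofReal (2 * π / β + 1) * hardyOp β (rearr volume f) m := by
  set c := ENNReal.ofReal (2 * π / β + 1) with hc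
  have hct : c ≠ ⊤ := ENNReal.ofReal_ne_top
  set κ : ℝ → ℝ≥0∞ := fun u => ENNReal.ofReal u *
    min (ENNReal.ofReal m ^ (β / 2 - 1)) (ENNReal.ofReal u ^ (β / 2 - 1)) with hκ
  refine le_of_forall_lt fun t ht => ?_
  obtain ⟨t', htt', ht'⟩ := exists_between ht
  refine lt_of_lt_of_le htt' ?_
  rw [lt_rearr_iff] at ht'
  obtain ⟨A, hAm, hAs, hA, hAt⟩ := Measure.exists_subset_measure_lt_top
    (measurableSet_lt measurable_const (measurable_rieszPot β hf)) ht'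
  have hA0 : volume A ≠ 0 := (zero_le.trans_lt hA).ne'
  -- the kernel integrated over a pair of sets
  have hpair : ∀ s : Set E2, MeasurableSet s →
      ∫⁻ y in s, ∫⁻ x in A, ‖x - y‖ₑ ^ (β - 2) ≤
        c * min (volume s * volume A ^ (β / 2)) (volume A * volume s ^ (β / 2)) := by
    intro s hs
    rw [mul_min]
    refine le_min ?_ ?_
    · calc _ ≤ ∫⁻ _ in s, c * volume A ^ (β / 2) := by
            refine lintegral_mono fun y => ?_
            simp_rw [← enorm_neg (_ - y), neg_sub]
            exact setLIntegral_enorm_sub_rpow_le hβ hβ2 y hAm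
        _ = _ := by
            rw [setLIntegral_const]
            ring
    · rw [lintegral_lintegral_swap (by fun_prop)]
      calc _ ≤ ∫⁻ _ in A, c * volume s ^ (β / 2) :=
            lintegral_mono fun x => setLIntegral_enorm_sub_rpow_le hβ hβ2 x hs
        _ = _ := by
            rw [setLIntegral_const]
            ring
  set J : E2 → ℝ≥0∞ := fun y => ∫⁻ x in A, ‖x - y‖ₑ ^ (β - 2) with hJ
  have hJm : Measurable J := Measurable.lintegral_prod_left'
    (f := fun z : E2 × E2 => ‖z.1 - z.2‖ₑ ^ (β - 2)) (by fun_prop)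
  have hswap : ∫⁻ x in A, rieszPot β f x = ∫⁻ y, f y * J y := by
    simp only [rieszPot]
    rw [lintegral_lintegral_swap (by fun_prop)]
    refine lintegral_congr fun y => ?_
    rw [lintegral_const_mul _ (by fun_prop)]
  set K : ℝ → ℝ → ℝ≥0∞ := fun s u => {z : ℝ × ℝ | ENNReal.ofReal z.1 <
    rearr (volume : Measure E2) f z.2}.indicator (fun z => ENNReal.ofReal z.1 * κ z.2) (s, u)
    with hK
  have hκm : Measurable κ := by fun_prop
  have hKm : Measurable (Function.uncurry K) := by
    refine Measurable.indicator (by fun_prop) (measurableSet_lt (by fun_prop) ?_)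
    exact (measurable_rearr f).comp measurable_snd
  have hfJ : ∫⁻ y, f y * J y ≤ c * volume A * ∫⁻ u, κ u * rearr volume f u ∂dilationMeasure := by
    have hlayer : ∀ y, f y * J y = ∫⁻ s, {z : ℝ × E2 | ENNReal.ofReal z.1 < f z.2}.indicator
        (fun z => ENNReal.ofReal z.1 * J z.2) (s, y) ∂dilationMeasure := by
      intro y
      have h1 := lintegral_dilationMeasure_rpow (f y) one_pos
      simp only [ENNReal.rpow_one, ENNReal.ofReal_one, div_one] at h1
      nth_rewrite 1 [← h1]
      rw [← lintegral_mul_const _ (Measurable.indicator (by fun_prop)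
        (measurableSet_lt (by fun_prop) measurable_const))]
      refine lintegral_congr fun s => ?_
      simp only [Set.indicator_apply, Set.mem_ofPred_eq]
      split_ifs <;> simp
    have hmeas : Measurable fun z : ℝ × E2 => {z : ℝ × E2 | ENNReal.ofReal z.1 < f z.2}.indicator
        (fun z => ENNReal.ofReal z.1 * J z.2) z :=
      Measurable.indicator (by fun_prop) (measurableSet_lt (by fun_prop) (by fun_prop))
    rw [lintegral_congr hlayer, lintegral_lintegral_swap (by
      exact (hmeas.comp measurable_swap).aemeasurable)]
    calc _ ≤ ∫⁻ s, c * volume A * ∫⁻ u, K s u ∂dilationMeasure ∂dilationMeasure := by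
          refine lintegral_mono fun s => ?_
          have hset : MeasurableSet {y | ENNReal.ofReal s < f y} :=
            measurableSet_lt measurable_const hf
          have e1 : ∀ y, {z : ℝ × E2 | ENNReal.ofReal z.1 < f z.2}.indicator
              (fun z => ENNReal.ofReal z.1 * J z.2) (s, y) =
              ENNReal.ofReal s * {y | ENNReal.ofReal s < f y}.indicator J y := by
            intro y
            simp only [Set.indicator_apply, Set.mem_ofPred_eq]
            split_ifs <;> simp
          have e2 : ∀ u, K s u = ENNReal.ofReal s *
              {u : ℝ | ENNReal.ofReal u < volume {y | ENNReal.ofReal s < f y}}.indicator κ u := by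
            intro u
            simp only [hK, Set.indicator_apply, Set.mem_ofPred_eq, lt_rearr_iff]
            split_ifs <;> simp
          simp only [e1, e2]
          rw [lintegral_const_mul' _ _ ENNReal.ofReal_ne_top,
            lintegral_const_mul' _ _ ENNReal.ofReal_ne_top, lintegral_indicator hset,
            mul_left_comm, mul_assoc c]
          gcongr
          exact (hpair _ hset).trans (by
            gcongr
            exact min_mul_rpow_le_lintegral (by positivity) (by linarith) hm hA.le hAt.ne)
      _ = _ := by
          rw [lintegral_const_mul' _ _ (ENNReal.mul_ne_top hct hAt.ne),
            lintegral_lintegral_swap hKm.aemeasurable]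
          congr 1
          refine lintegral_congr fun u => ?_
          have e3 : ∀ s, K s u = {s : ℝ | ENNReal.ofReal s < rearr volume f u}.indicator
              (fun s => ENNReal.ofReal s) s * κ u := by
            intro s
            simp only [hK, Set.indicator_apply, Set.mem_ofPred_eq]
            split_ifs <;> simp
          have h1 := lintegral_dilationMeasure_rpow (rearr volume f u) one_pos
          simp only [ENNReal.rpow_one, ENNReal.ofReal_one, div_one] at h1
          rw [lintegral_congr e3, lintegral_mul_const _ (Measurable.indicator (by fun_prop)
            (measurableSet_lt (by fun_prop) measurable_const)), h1, mul_comm]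
  rw [← ENNReal.mul_le_mul_iff_left hA0 hAt.ne]
  calc t' * volume A = ∫⁻ _ in A, t' := by rw [setLIntegral_const]
    _ ≤ ∫⁻ x in A, rieszPot β f x := setLIntegral_mono' hAm fun x hx => (hAs hx).le
    _ ≤ _ := by
      rw [hswap, hardyOp_eq β _ hm]
      refine hfJ.trans (le_of_eq ?_)
      ring

/-! ### Lorentz norms through rearrangements -/

lemma iSup_mul_measure_rpow_eq {X : Type*} [MeasurableSpace X] (μ : Measure X) (F : X → ℝ≥0∞)
    {p : ℝ} (hp : 0 < p) :
    ⨆ t : ℝ≥0, (t : ℝ≥0∞) * μ {x | (t : ℝ≥0∞) < F x} ^ (1 / p) =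
      ⨆ m ∈ Set.Ioi (0 : ℝ), ENNReal.ofReal m ^ (1 / p) * rearr μ F m := by
  have hp' : 0 < 1 / p := by positivity
  apply le_antisymm
  · refine iSup_le fun t => ?_
    rcases eq_or_ne t 0 with rfl | ht
    · simp
    have ht0 : (t : ℝ≥0∞) ≠ 0 := by simpa using ht
    rw [mul_comm, ← ENNReal.le_div_iff_mul_le (Or.inl ht0) (Or.inl ENNReal.coe_ne_top),
      one_div, ENNReal.rpow_inv_le_iff hp]
    refine le_of_forall_lt_imp_le_of_dense fun c hc => ?_
    rw [← ENNReal.rpow_inv_le_iff hp, ← one_div,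
      ENNReal.le_div_iff_mul_le (Or.inl ht0) (Or.inl ENNReal.coe_ne_top)]
    rcases eq_or_ne c 0 with rfl | hc0
    · rw [ENNReal.zero_rpow_of_pos hp', zero_mul]
      exact zero_le
    have hct : c ≠ ⊤ := hc.ne_top
    refine le_iSup₂_of_le c.toReal (ENNReal.toReal_pos hc0 hct) ?_
    rw [ENNReal.ofReal_toReal hct]
    gcongr
    refine (lt_rearr_iff.2 ?_).le
    rwa [ENNReal.ofReal_toReal hct]
  · refine iSup₂_le fun m hm => ?_
    have hm0 : ENNReal.ofReal m ≠ 0 := by simpa using hm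
    have h0 : ENNReal.ofReal m ^ (1 / p) ≠ 0 := by simp [hm0, ENNReal.ofReal_ne_top]
    have h1 : ENNReal.ofReal m ^ (1 / p) ≠ ⊤ :=
      ENNReal.rpow_ne_top_of_nonneg hp'.le ENNReal.ofReal_ne_top
    rw [mul_comm, ← ENNReal.le_div_iff_mul_le (Or.inl h0) (Or.inl h1)]
    refine le_of_forall_lt_imp_le_of_dense fun c hc => ?_
    rw [ENNReal.le_div_iff_mul_le (Or.inl h0) (Or.inl h1)]
    refine le_iSup_of_le c.toNNReal ?_
    rw [ENNReal.coe_toNNReal hc.ne_top]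
    gcongr
    exact (lt_rearr_iff.1 hc).le

lemma lorentzNorm_eq {p : ℝ} (hp : 0 < p) {q : ℝ≥0∞} (hq : 1 ≤ q) (f : E2 → ℝ) (s : Set E2) :
    lorentzNorm p q f s = ENNReal.ofReal p ^ (-(1 / q.toReal)) * dilationNorm q fun m =>
      ENNReal.ofReal m ^ (1 / p) * rearr volume (s.indicator fun x => ‖f x‖ₑ) m := by
  have hset : ∀ t : ℝ, 0 ≤ t → {x ∈ s | t < |f x|} =
      {x | ENNReal.ofReal t < s.indicator (fun x => ‖f x‖ₑ) x} := by
    intro t ht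
    ext x
    by_cases hx : x ∈ s
    · simp [hx, Real.enorm_eq_ofReal_abs, ENNReal.ofReal_lt_ofReal_iff_of_nonneg ht]
    · simp [hx]
  rcases eq_or_ne q ⊤ with rfl | hqt
  · rw [dilationNorm_top, ← iSup_mul_measure_rpow_eq volume _ hp]
    simp only [lorentzNorm, wnorm, if_true, hset _ (NNReal.coe_nonneg _),
      ENNReal.ofReal_coe_nnreal, ENNReal.toReal_top, div_zero, neg_zero, ENNReal.rpow_zero, one_mul]
  · have hq0 : 0 < q.toReal := ENNReal.toReal_pos (zero_lt_one.trans_le hq).ne' hqt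
    rw [dilationNorm_of_ne_top hqt, lorentzNorm, if_neg hqt,
      ENNReal.rpow_neg, ← ENNReal.inv_rpow,
      ← ENNReal.mul_rpow_of_nonneg _ _ (by positivity : 0 ≤ 1 / q.toReal),
      ← lintegral_distribution_eq_lintegral_rearr volume _ hp hq0, lintegral_dilationMeasure]
    congr 1
    refine setLIntegral_congr_fun measurableSet_Ioi fun t ht => ?_
    simp only [hset t (le_of_lt ht)]

lemma dilationNorm_two_rearr {X : Type*} [MeasurableSpace X] (μ : Measure X) {f : X → ℝ}
    (hf0 : ∀ x, 0 ≤ f x) (hf : Measurable f) :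
    dilationNorm 2 (fun m => ENNReal.ofReal m ^ (1 / 2 : ℝ) *
      rearr μ (fun x => ENNReal.ofReal (f x)) m) =
        (∫⁻ x, ENNReal.ofReal (f x ^ 2) ∂μ) ^ (1 / 2 : ℝ) := by
  have h1 := lintegral_distribution_eq_lintegral_rearr μ (fun x => ENNReal.ofReal (f x))
    two_pos two_pos
  have h2 := lintegral_rpow_eq_lintegral_meas_lt_mul μ (Filter.Eventually.of_forall hf0)
    hf.aemeasurable two_pos
  rw [dilationNorm_of_ne_top (by simp)]
  simp only [ENNReal.toReal_ofNat]
  congr 1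
  have h3 : ENNReal.ofReal 2 ≠ 0 := by simp
  simp only [Real.rpow_two] at h2
  rw [h2, ← one_mul (lintegral _ _), ← ENNReal.mul_inv_cancel h3 ENNReal.ofReal_ne_top, mul_assoc,
    ← h1, lintegral_dilationMeasure]
  congr 1
  refine setLIntegral_congr_fun measurableSet_Ioi fun t ht => ?_
  have ht : 0 < t := ht
  have ht0 : ENNReal.ofReal t ≠ 0 := by simpa using ht
  rw [show (2 : ℝ) - 1 = 1 by norm_num, Real.rpow_one, ENNReal.mul_rpow_of_nonneg _ _ zero_le_two,
    ← ENNReal.rpow_mul, one_div, inv_mul_cancel₀ two_ne_zero, ENNReal.rpow_one]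
  simp only [ENNReal.ofReal_lt_ofReal_iff_of_nonneg ht.le]
  rw [mul_comm (_ ^ _), mul_div_assoc]
  congr 1
  rw [ENNReal.rpow_two, pow_two, mul_div_assoc, ENNReal.div_self ht0 ENNReal.ofReal_ne_top, mul_one]

lemma dilationNorm_rpow_mul_comp_mul_le {q : ℝ≥0∞} (hq : 1 ≤ q) (G : ℝ → ℝ≥0∞) {e v : ℝ}
    (he : 0 ≤ e) (he1 : e ≤ 1) (hv : 0 < v) (hv1 : v ≤ 1) :
    dilationNorm q (fun m => ENNReal.ofReal m ^ e * G (m * v)) ≤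
      ENNReal.ofReal (1 / v) * dilationNorm q fun m => ENNReal.ofReal m ^ e * G m := by
  calc _ ≤ dilationNorm q fun m => ENNReal.ofReal (1 / v) *
        (ENNReal.ofReal (m * v) ^ e * G (m * v)) := by
        refine dilationNorm_mono q fun m hm => ?_
        rw [← mul_assoc]
        gcongr
        rw [ENNReal.ofReal_rpow_of_nonneg hm.le he,
          ENNReal.ofReal_rpow_of_nonneg (by positivity) he, ← ENNReal.ofReal_mul (by positivity)]
        refine ENNReal.ofReal_le_ofReal ?_
        rw [mul_rpow hm.le hv.le, one_div, ← mul_assoc, mul_comm v⁻¹, mul_assoc]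
        refine le_mul_of_one_le_right (by positivity) ?_
        rw [← rpow_neg_one, ← rpow_add hv]
        exact one_le_rpow_of_pos_of_le_one_of_nonpos hv hv1 (by linarith)
    _ = ENNReal.ofReal (1 / v) *
        dilationNorm q fun m => (fun n => ENNReal.ofReal n ^ e * G n) (m * v) :=
        dilationNorm_const_mul hq ENNReal.ofReal_ne_top _
    _ ≤ _ := mul_le_mul_right (dilationNorm_comp_mul q _ hv) _

/-- Lorentz bound for the bilinear potential that controls the solution. -/
lemma dilationNorm_rearr_bilinear_le {p M : ℝ} (hp : 1 < p) (hpM : p ≤ M) (hpM' : p / (p - 1) ≤ M)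
    {q qs : ℝ≥0∞} (hq : 2 ≤ q) (hqs : 1 / qs = 1 / 2 + 1 / q) (hqs1 : 1 ≤ qs)
    {K : ℝ≥0∞} (hK : K ≠ ⊤) {g h u : E2 → ℝ≥0∞} (hg : Measurable g) (hh : Measurable h)
    (hu : ∀ x, u x ≤ K * (rieszPot (1 / p) g x * rieszPot (1 - 1 / p) h x +
      rieszPot (1 - 1 / p) (fun y => h y * rieszPot (1 / p) g y) x)) :
    dilationNorm qs (fun m => ENNReal.ofReal m ^ (1 / p) * rearr volume u m) ≤
      K * ENNReal.ofReal (128 * (2 * π * M + 1) ^ 2 * M ^ 2) *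
        (dilationNorm q (fun m => ENNReal.ofReal m ^ (1 / p) * rearr volume g m) *
        dilationNorm 2 fun m => ENNReal.ofReal m ^ (1 / 2 : ℝ) * rearr volume h m) := by
  have hp0 : 0 < p := by linarith
  have hp1 : 0 < p - 1 := by linarith
  have hM : 1 < M := by linarith
  have hα0 : 0 < 1 / p := by positivity
  have hα1 : 1 / p < 1 := by rw [div_lt_one hp0]; exact hp
  have hq1 : 1 ≤ q := one_le_two.trans hq
  set α := 1 / p with hα
  set c := ENNReal.ofReal (2 * π * M + 1) with hc
  have hct : c ≠ ⊤ := ENNReal.ofReal_ne_top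
  set S := ENNReal.ofReal (4 * M) with hS
  have hcα : ENNReal.ofReal (2 * π / α + 1) ≤ c := by
    refine ENNReal.ofReal_le_ofReal ?_
    have : 2 * π / α = 2 * π * p := by rw [hα]; field_simp
    rw [this]
    gcongr
  have hcβ : ENNReal.ofReal (2 * π / (1 - α) + 1) ≤ c := by
    refine ENNReal.ofReal_le_ofReal ?_
    have : 2 * π / (1 - α) = 2 * π * (p / (p - 1)) := by rw [hα]; field_simp
    rw [this]
    gcongr
  have hH1 : hardyConst α α ≤ S := by
    refine (hardyConst_le hα1 (by linarith)).trans (ENNReal.ofReal_le_ofReal ?_)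
    have : 1 / (1 - α) + 1 / (α - α / 2) = p / (p - 1) + 2 * p := by
      rw [hα]; field_simp; norm_num
    linarith
  have hH2 : hardyConst (1 / 2) (1 - α) ≤ S := by
    refine (hardyConst_le (by norm_num) (by linarith)).trans (ENNReal.ofReal_le_ofReal ?_)
    have : 1 / (1 - 1 / 2) + 1 / (1 / 2 - (1 - α) / 2) = 2 + 2 * p := by
      rw [hα, show (1 / 2 - (1 - 1 / p) / 2 : ℝ) = 1 / (2 * p) by field_simp; ring]
      norm_num
    linarith
  have hH3 : hardyConst (1 / 2 + α / 2) (1 - α) ≤ S := by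
    refine (hardyConst_le (by linarith) (by linarith)).trans (ENNReal.ofReal_le_ofReal ?_)
    have : 1 / (1 - (1 / 2 + α / 2)) + 1 / (1 / 2 + α / 2 - (1 - α) / 2) =
        2 * (p / (p - 1)) + p := by
      rw [show (1 / 2 + α / 2 - (1 - α) / 2 : ℝ) = α by ring,
        show (1 - (1 / 2 + α / 2) : ℝ) = (1 - α) / 2 by ring, hα]
      field_simp
    linarith
  set Ng := dilationNorm q (fun m => ENNReal.ofReal m ^ α * rearr volume g m) with hNg
  set Nh := dilationNorm 2 (fun m => ENNReal.ofReal m ^ (1 / 2 : ℝ) * rearr volume h m) with hNh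
  set A := hardyOp α (rearr volume g) with hA
  set B := hardyOp (1 - α) (rearr volume h) with hB
  set H := rearr volume (fun y => h y * rieszPot α g y) with hHdef
  have hgm : Measurable (rearr volume g) := measurable_rearr g
  have hhm : Measurable (rearr volume h) := measurable_rearr h
  have hHm : Measurable H := measurable_rearr _
  have hAm : Measurable A := measurable_hardyOp _ hgm
  have hBm : Measurable B := measurable_hardyOp _ hhm
  have hHop : Measurable (hardyOp (1 - α) H) := measurable_hardyOp _ hHm
  have hIg : Measurable (rieszPot α g) := measurable_rieszPot _ hg
  have hIA : ∀ m, 0 < m → rearr volume (rieszPot α g) m ≤ c * A m := fun m hm =>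
    (rearr_rieszPot_le hα0 (by linarith) hg hm).trans (mul_le_mul_left hcα _)
  have hIB : ∀ m, 0 < m → rearr volume (rieszPot (1 - α) h) m ≤ c * B m := fun m hm =>
    (rearr_rieszPot_le (by linarith) (by linarith) hh hm).trans (mul_le_mul_left hcβ _)
  have hHle : ∀ m, 0 < m → H m ≤ c * (rearr volume h (m * 2⁻¹) * A (m * 2⁻¹)) := by
    intro m hm
    have hm2 : 0 < m * 2⁻¹ := by positivity
    calc H m = H (m * 2⁻¹ + m * 2⁻¹) := by ring_nf
      _ ≤ _ := rearr_mul_le hm2.le hm2.le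
      _ ≤ rearr volume h (m * 2⁻¹) * (c * A (m * 2⁻¹)) := by gcongr; exact hIA _ hm2
      _ = _ := by ring
  have hpt : ∀ m, 0 < m → rearr volume u m ≤
      K * (c ^ 2 * (A (m * 4⁻¹) * B (m * 4⁻¹)) + c * hardyOp (1 - α) H (m * 2⁻¹)) := by
    intro m hm
    have hm2 : 0 < m * 2⁻¹ := by positivity
    have hm4 : 0 < m * 4⁻¹ := by positivity
    refine (rearr_mono hu m).trans ((rearr_const_mul_le K m).trans (mul_le_mul_right ?_ K))
    conv_lhs => rw [show m = m * 2⁻¹ + m * 2⁻¹ by ring]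
    refine (rearr_add_le hm2.le hm2.le).trans (add_le_add ?_ ?_)
    · rw [show m * 2⁻¹ = m * 4⁻¹ + m * 4⁻¹ by ring]
      refine (rearr_mul_le hm4.le hm4.le).trans ((mul_le_mul' (hIA _ hm4) (hIB _ hm4)).trans_eq ?_)
      ring
    · exact (rearr_rieszPot_le (by linarith) (by linarith) (hh.mul hIg) hm2).trans
        (mul_le_mul_left hcβ _)
  have hAN : dilationNorm q (fun m => ENNReal.ofReal m ^ (α / 2) * A m) ≤ S * Ng := by
    have := dilationNorm_hardyOp_le α α hq1 hgm
    rw [show α - α / 2 = α / 2 by ring] at this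
    exact this.trans (mul_le_mul_left hH1 _)
  have hBN : dilationNorm 2 (fun m => ENNReal.ofReal m ^ (α / 2) * B m) ≤ S * Nh := by
    have := dilationNorm_hardyOp_le (1 / 2) (1 - α) one_le_two hhm
    rw [show 1 / 2 - (1 - α) / 2 = α / 2 by ring] at this
    exact this.trans (mul_le_mul_left hH2 _)
  have hsplit : ∀ (m x y : ℝ) (X Y : ℝ≥0∞), 0 < m → ENNReal.ofReal m ^ (x + y) * (X * Y) =
      ENNReal.ofReal m ^ x * X * (ENNReal.ofReal m ^ y * Y) := by
    intro m x y X Y hm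
    rw [ENNReal.rpow_add _ _ (by simpa using hm) ENNReal.ofReal_ne_top]
    ring
  have hT1 : dilationNorm qs (fun m => ENNReal.ofReal m ^ α * (A (m * 4⁻¹) * B (m * 4⁻¹))) ≤
      4 * (S * Ng * (S * Nh)) := by
    refine (dilationNorm_rpow_mul_comp_mul_le hqs1 (fun m => A m * B m) hα0.le hα1.le
      (by norm_num) (by norm_num)).trans ?_
    rw [show ENNReal.ofReal (1 / 4⁻¹) = 4 by norm_num]
    gcongr
    calc _ ≤ dilationNorm qs (fun m => (ENNReal.ofReal m ^ (α / 2) * A m) *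
          (ENNReal.ofReal m ^ (α / 2) * B m)) := by
          refine dilationNorm_mono qs fun m hm => (le_of_eq ?_)
          rw [← hsplit _ _ _ _ _ hm, add_halves]
      _ ≤ _ := dilationNorm_mul_le hqs hq (by fun_prop) (by fun_prop)
      _ ≤ _ := mul_le_mul' hAN hBN
  have hT2 : dilationNorm qs (fun m => ENNReal.ofReal m ^ α * hardyOp (1 - α) H (m * 2⁻¹)) ≤
      2 * (S * (c * (2 * (S * Ng * Nh)))) := by
    refine (dilationNorm_rpow_mul_comp_mul_le hqs1 (hardyOp (1 - α) H) hα0.le hα1.le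
      (by norm_num) (by norm_num)).trans ?_
    rw [show ENNReal.ofReal (1 / 2⁻¹) = 2 by norm_num]
    gcongr
    have := dilationNorm_hardyOp_le (1 / 2 + α / 2) (1 - α) hqs1 hHm
    rw [show 1 / 2 + α / 2 - (1 - α) / 2 = α by ring] at this
    refine this.trans (mul_le_mul' hH3 ?_)
    calc _ ≤ dilationNorm qs (fun m => c * (ENNReal.ofReal m ^ (1 / 2 + α / 2) *
          (fun n => rearr volume h n * A n) (m * 2⁻¹))) := by
          refine dilationNorm_mono qs fun m hm => ?_
          refine (mul_le_mul_right (hHle m hm) _).trans_eq ?_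
          ring
      _ ≤ c * (2 * dilationNorm qs (fun m => ENNReal.ofReal m ^ (1 / 2 + α / 2) *
          (rearr volume h m * A m))) := by
          rw [dilationNorm_const_mul hqs1 hct]
          gcongr
          refine (dilationNorm_rpow_mul_comp_mul_le hqs1 (fun n => rearr volume h n * A n)
            (by linarith) (by linarith) (by norm_num) (by norm_num)).trans_eq ?_
          rw [show ENNReal.ofReal (1 / 2⁻¹) = 2 by norm_num]
      _ ≤ _ := by
          gcongr
          calc _ ≤ dilationNorm qs (fun m => (ENNReal.ofReal m ^ (α / 2) * A m) *
                (ENNReal.ofReal m ^ (1 / 2 : ℝ) * rearr volume h m)) := by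
                refine dilationNorm_mono qs fun m hm => (le_of_eq ?_)
                rw [hsplit _ _ _ _ _ hm, mul_comm]
            _ ≤ _ := dilationNorm_mul_le hqs hq (by fun_prop) (by fun_prop)
            _ ≤ _ := mul_le_mul' hAN le_rfl
  have hS1 : 1 ≤ S := by
    rw [hS, ← ENNReal.ofReal_one]
    exact ENNReal.ofReal_le_ofReal (by linarith)
  calc _ ≤ dilationNorm qs (fun m => K * (c ^ 2 * (ENNReal.ofReal m ^ α *
        (A (m * 4⁻¹) * B (m * 4⁻¹))) + c * (ENNReal.ofReal m ^ α *
          hardyOp (1 - α) H (m * 2⁻¹)))) := by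
        refine dilationNorm_mono qs fun m hm => ?_
        refine (mul_le_mul_right (hpt m hm) _).trans_eq ?_
        ring
    _ = K * dilationNorm qs (fun m => c ^ 2 * (ENNReal.ofReal m ^ α *
        (A (m * 4⁻¹) * B (m * 4⁻¹))) + c * (ENNReal.ofReal m ^ α *
          hardyOp (1 - α) H (m * 2⁻¹))) := dilationNorm_const_mul hqs1 hK _
    _ ≤ K * (c ^ 2 * (4 * (S * Ng * (S * Nh))) + c * (2 * (S * (c * (2 * (S * Ng * Nh)))))) := by
        gcongr
        refine (dilationNorm_add_le hqs1 (by fun_prop) (by fun_prop)).trans (add_le_add ?_ ?_)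
        · rw [dilationNorm_const_mul hqs1 (ENNReal.pow_ne_top hct)]
          gcongr
        · rw [dilationNorm_const_mul hqs1 hct]
          gcongr
    _ = K * (8 * c ^ 2 * S ^ 2) * (Ng * Nh) := by ring
    _ = _ := by
        congr 2
        rw [hc, hS, ← ENNReal.ofReal_pow (by positivity), ← ENNReal.ofReal_pow (by positivity),
          show (8 : ℝ≥0∞) = ENNReal.ofReal 8 by norm_num, ← ENNReal.ofReal_mul (by positivity),
          ← ENNReal.ofReal_mul (by positivity)]
        congr 1
        ring

/-! ### Differences controlled by Riesz potentials of the gradient -/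

lemma enorm_sub_le_lintegral_fderiv {D : Set E2} (hD : IsOpen D) (hconv : Convex ℝ D) {b : E2 → ℝ}
    (hb : ContDiffOn ℝ 1 b D) {x z : E2} (hx : x ∈ D) (hz : z ∈ D) :
    ‖b z - b x‖ₑ ≤ ∫⁻ t in Set.Ioc (0 : ℝ) 1,
      D.indicator (fun w => ‖fderiv ℝ b w‖ₑ) (x + t • (z - x)) * ‖z - x‖ₑ := by
  have hmem : ∀ t ∈ Set.Icc (0 : ℝ) 1, x + t • (z - x) ∈ D := fun t ht =>
    hconv.add_smul_sub_mem hx hz ht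
  have hline : ∀ t : ℝ, HasDerivAt (fun t : ℝ => x + t • (z - x)) (z - x) t := fun t => by
    simpa using ((hasDerivAt_id t).smul_const (z - x)).const_add x
  have hderiv : ∀ t ∈ Set.uIcc (0 : ℝ) 1, HasDerivAt (fun t : ℝ => b (x + t • (z - x)))
      (fderiv ℝ b (x + t • (z - x)) (z - x)) t := by
    intro t ht
    rw [Set.uIcc_of_le zero_le_one] at ht
    have hd : DifferentiableAt ℝ b (x + t • (z - x)) :=
      (hb.differentiableOn one_ne_zero).differentiableAt (hD.mem_nhds (hmem t ht))
    exact hd.hasFDerivAt.comp_hasDerivAt t (hline t)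
  have hcont : ContinuousOn (fun t : ℝ => fderiv ℝ b (x + t • (z - x)) (z - x))
      (Set.uIcc (0 : ℝ) 1) := by
    rw [Set.uIcc_of_le zero_le_one]
    refine ContinuousOn.clm_apply ?_ continuousOn_const
    exact (hb.continuousOn_fderiv_of_isOpen hD le_rfl).comp (by fun_prop) hmem
  have hftc := intervalIntegral.integral_eq_sub_of_hasDerivAt hderiv hcont.intervalIntegrable
  simp only [one_smul, zero_smul, add_zero, add_sub_cancel] at hftc
  rw [← hftc, intervalIntegral.integral_of_le zero_le_one]
  refine (enorm_integral_le_lintegral_enorm _).trans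
    (setLIntegral_mono' measurableSet_Ioc fun t ht => ?_)
  rw [Set.indicator_of_mem (hmem t ⟨ht.1.le, ht.2⟩)]
  exact ContinuousLinearMap.le_opENorm _ _

lemma lintegral_closedBall_comp_smul_le {α : ℝ} (hα1 : α < 1) {g : E2 → ℝ≥0∞}
    (hg : Measurable g) (x : E2) {ρ t : ℝ} (ht : 0 < t) :
    ∫⁻ z in closedBall x ρ, g (x + t • (z - x)) * ‖z - x‖ₑ ≤
      ENNReal.ofReal (t ^ (-α)) * (ENNReal.ofReal ρ ^ (3 - α) * rieszPot α g x) := by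
  have ht0 : ENNReal.ofReal t ≠ 0 := by simpa using ht
  have hpt : ∀ z : E2, (closedBall x ρ).indicator (fun z => g (x + t • (z - x)) * ‖z - x‖ₑ) z ≤
      ENNReal.ofReal t ^ (2 - α) * ENNReal.ofReal ρ ^ (3 - α) *
        (g (x + t • (z - x)) * ‖t • (z - x)‖ₑ ^ (α - 2)) := by
    intro z
    by_cases hz : z ∈ closedBall x ρ
    swap
    · rw [Set.indicator_of_notMem hz]
      exact zero_le
    rw [Set.indicator_of_mem hz]
    rcases eq_or_ne (z - x) 0 with h0 | h0
    · simp [h0]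
    have hn0 : ‖z - x‖ₑ ≠ 0 := by simpa using h0
    have hzρ : ‖z - x‖ₑ ≤ ENNReal.ofReal ρ := by
      rw [← ofReal_norm]
      exact ENNReal.ofReal_le_ofReal (by simpa [dist_eq_norm] using hz)
    have hz1 : ‖z - x‖ₑ = ENNReal.ofReal t ^ (2 - α) * ‖z - x‖ₑ ^ (3 - α) *
        ‖t • (z - x)‖ₑ ^ (α - 2) := by
      rw [enorm_smul, Real.enorm_of_nonneg ht.le,
        ENNReal.mul_rpow_of_ne_top ENNReal.ofReal_ne_top enorm_ne_top, mul_mul_mul_comm,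
        ← ENNReal.rpow_add _ _ ht0 ENNReal.ofReal_ne_top, ← ENNReal.rpow_add _ _ hn0 enorm_ne_top]
      norm_num
    calc g (x + t • (z - x)) * ‖z - x‖ₑ = ENNReal.ofReal t ^ (2 - α) * ‖z - x‖ₑ ^ (3 - α) *
        (g (x + t • (z - x)) * ‖t • (z - x)‖ₑ ^ (α - 2)) := by
          nth_rewrite 1 [hz1]
          ring
      _ ≤ _ := by
          refine mul_le_mul_left (mul_le_mul_right ?_ _) _
          exact ENNReal.rpow_le_rpow hzρ (by linarith)
  have hint : ∫⁻ z, g (x + t • (z - x)) * ‖t • (z - x)‖ₑ ^ (α - 2) =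
      (ENNReal.ofReal t ^ 2)⁻¹ * rieszPot α g x := by
    have h := lintegral_comp_smul_addHaar (volume : Measure E2)
      (fun w => g (x + w) * ‖w‖ₑ ^ (α - 2)) ht
    rw [show Module.finrank ℝ E2 = 2 by simp] at h
    rw [← lintegral_add_left_eq_self _ x]
    simp only [add_sub_cancel_left]
    rw [h, rieszPot, ← lintegral_add_left_eq_self (fun y => g y * ‖x - y‖ₑ ^ (α - 2)) x]
    simp
  rw [← lintegral_indicator measurableSet_closedBall]
  refine (lintegral_mono hpt).trans_eq ?_
  rw [lintegral_const_mul _ (by fun_prop), hint, ← ENNReal.ofReal_rpow_of_pos ht,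
    show -α = (2 - α) + -2 by ring, ENNReal.rpow_add _ _ ht0 ENNReal.ofReal_ne_top,
    ENNReal.rpow_neg _ 2, ENNReal.rpow_two]
  ring

lemma setLIntegral_enorm_sub_le_rieszPot {α : ℝ} (hα1 : α < 1) {D S : Set E2}
    (hD : IsOpen D) (hconv : Convex ℝ D) {b : E2 → ℝ} (hb : ContDiffOn ℝ 1 b D) {x : E2}
    (hx : x ∈ D) (hS : MeasurableSet S) (hSD : S ⊆ D) {ρ : ℝ}
    (hSρ : S ⊆ closedBall x ρ) :
    ∫⁻ z in S, ‖b z - b x‖ₑ ≤ ENNReal.ofReal (1 / (1 - α)) * (ENNReal.ofReal ρ ^ (3 - α) *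
      rieszPot α (D.indicator fun w => ‖fderiv ℝ b w‖ₑ) x) := by
  set g := D.indicator fun w => ‖fderiv ℝ b w‖ₑ with hg
  have hgm : Measurable g := (measurable_fderiv ℝ b).enorm.indicator hD.measurableSet
  have hint : ∫⁻ t in Set.Ioc (0 : ℝ) 1, ENNReal.ofReal (t ^ (-α)) =
      ENNReal.ofReal (1 / (1 - α)) := by
    rw [← ofReal_integral_eq_lintegral_ofReal, ← intervalIntegral.integral_of_le zero_le_one,
      integral_rpow (Or.inl (by linarith))]
    · have : -α + 1 ≠ 0 := by linarith
      simp [this, sub_eq_add_neg, add_comm]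
    · exact (intervalIntegrable_iff_integrableOn_Ioc_of_le zero_le_one).1
        (intervalIntegral.intervalIntegrable_rpow' (by linarith))
    · filter_upwards [ae_restrict_mem measurableSet_Ioc] with t ht
      exact rpow_nonneg ht.1.le _
  calc _ ≤ ∫⁻ z in S, ∫⁻ t in Set.Ioc (0 : ℝ) 1, g (x + t • (z - x)) * ‖z - x‖ₑ :=
        setLIntegral_mono' hS fun z hz => enorm_sub_le_lintegral_fderiv hD hconv hb hx (hSD hz)
    _ = ∫⁻ t in Set.Ioc (0 : ℝ) 1, ∫⁻ z in S, g (x + t • (z - x)) * ‖z - x‖ₑ :=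
        lintegral_lintegral_swap (by fun_prop)
    _ ≤ ∫⁻ t in Set.Ioc (0 : ℝ) 1, ENNReal.ofReal (t ^ (-α)) *
        (ENNReal.ofReal ρ ^ (3 - α) * rieszPot α g x) :=
        setLIntegral_mono' measurableSet_Ioc fun t ht => (lintegral_mono_set hSρ).trans
          (lintegral_closedBall_comp_smul_le hα1 hgm x ht.1)
    _ = _ := by rw [lintegral_mul_const _ (by fun_prop), hint]

lemma enorm_sub_le_rieszPot {α : ℝ} (hα0 : 0 < α) (hα1 : α < 1) (c : E2) {r : ℝ} (hr : 0 < r)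
    {b : E2 → ℝ} (hb : ContDiffOn ℝ 1 b (ball c r)) {x y : E2} (hx : x ∈ ball c r)
    (hy : y ∈ ball c r) :
    ‖b x - b y‖ₑ ≤ ENNReal.ofReal (16 / (1 - α)) * ‖x - y‖ₑ ^ (1 - α) *
      (rieszPot α ((ball c r).indicator fun w => ‖fderiv ℝ b w‖ₑ) x +
        rieszPot α ((ball c r).indicator fun w => ‖fderiv ℝ b w‖ₑ) y) := by
  set g := (ball c r).indicator fun w => ‖fderiv ℝ b w‖ₑ with hg
  rcases eq_or_ne x y with rfl | hxy
  · simp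
  set d := ‖x - y‖ with hd
  have hd0 : 0 < d := norm_pos_iff.2 (sub_ne_zero.2 hxy)
  have hxc : ‖x - c‖ < r := by simpa [dist_eq_norm] using hx
  have hyc : ‖y - c‖ < r := by simpa [dist_eq_norm] using hy
  have hd2 : d < 2 * r := by
    calc d = ‖(x - c) - (y - c)‖ := by rw [sub_sub_sub_cancel_right]
      _ ≤ ‖x - c‖ + ‖y - c‖ := norm_sub_le _ _
      _ < 2 * r := by linarith
  set lam := d / (2 * r) with hl
  have hl0 : 0 < lam := by positivity
  have hl1 : lam < 1 := by rw [hl, div_lt_one (by positivity)]; exact hd2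
  have hlr : lam * r = d / 2 := by rw [hl]; field_simp
  set o := x + lam • (c - x) with ho
  set S := ball o (d / 2) with hS
  have hox : ‖o - x‖ ≤ d / 2 := by
    rw [ho, add_sub_cancel_left, norm_smul, norm_sub_rev, Real.norm_of_nonneg hl0.le, ← hlr]
    gcongr
  have hoc : ‖o - c‖ ≤ r - d / 2 := by
    rw [show o - c = (1 - lam) • (x - c) by rw [ho]; module, norm_smul,
      Real.norm_of_nonneg (by linarith), ← hlr]
    nlinarith
  have hSD : S ⊆ ball c r := ball_subset_ball' (by rw [dist_eq_norm]; linarith)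
  have hSx : S ⊆ closedBall x (2 * d) :=
    ball_subset_closedBall.trans (closedBall_subset_closedBall' (by rw [dist_eq_norm]; linarith))
  have hSy : S ⊆ closedBall y (2 * d) := by
    refine ball_subset_closedBall.trans (closedBall_subset_closedBall' ?_)
    have : ‖o - y‖ ≤ ‖o - x‖ + ‖x - y‖ := norm_sub_le_norm_sub_add_norm_sub _ _ _
    rw [dist_eq_norm]
    linarith
  have hIx := setLIntegral_enorm_sub_le_rieszPot hα1 isOpen_ball (convex_ball c r) hb hx
    measurableSet_ball hSD hSx
  have hIy := setLIntegral_enorm_sub_le_rieszPot hα1 isOpen_ball (convex_ball c r) hb hy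
    measurableSet_ball hSD hSy
  have hbm : AEMeasurable (fun z => ‖b z - b x‖ₑ) (volume.restrict S) :=
    (((hb.continuousOn.mono hSD).sub continuousOn_const).aemeasurable measurableSet_ball).enorm
  have hvol : volume S = ENNReal.ofReal (π * d ^ 2 / 4) := by
    rw [hS, EuclideanSpace.volume_ball_fin_two, ← ENNReal.ofReal_pow (by positivity),
      ← ENNReal.ofReal_mul (by positivity)]
    congr 1
    ring
  have hvol0 : volume S ≠ 0 := by
    rw [hvol]
    simp only [ne_eq, ENNReal.ofReal_eq_zero, not_le]
    positivity
  have hvolt : volume S ≠ ⊤ := by rw [hvol]; exact ENNReal.ofReal_ne_top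
  have hmain : volume S * ‖b x - b y‖ₑ ≤ ENNReal.ofReal (1 / (1 - α)) *
      (ENNReal.ofReal (2 * d) ^ (3 - α) * (rieszPot α g x + rieszPot α g y)) := by
    calc volume S * ‖b x - b y‖ₑ = ∫⁻ _ in S, ‖b x - b y‖ₑ := by
          rw [setLIntegral_const, mul_comm]
      _ ≤ ∫⁻ z in S, (‖b z - b x‖ₑ + ‖b z - b y‖ₑ) := by
          refine lintegral_mono fun z => ?_
          rw [show b x - b y = (b z - b y) - (b z - b x) by ring, add_comm]
          exact enorm_sub_le
      _ = (∫⁻ z in S, ‖b z - b x‖ₑ) + ∫⁻ z in S, ‖b z - b y‖ₑ := lintegral_add_left' hbm _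
      _ ≤ _ := (add_le_add hIx hIy).trans_eq (by ring)
  have hconst : ENNReal.ofReal (1 / (1 - α)) * ENNReal.ofReal (2 * d) ^ (3 - α) ≤
      volume S * (ENNReal.ofReal (16 / (1 - α)) * ‖x - y‖ₑ ^ (1 - α)) := by
    rw [hvol, ← ofReal_norm, ← hd, ENNReal.ofReal_rpow_of_pos (by positivity),
      ENNReal.ofReal_rpow_of_pos hd0, ← ENNReal.ofReal_mul (by positivity),
      ← ENNReal.ofReal_mul (by positivity), ← ENNReal.ofReal_mul (by positivity)]
    refine ENNReal.ofReal_le_ofReal ?_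
    have h1 : (2 : ℝ) ^ (3 - α) ≤ 8 := by
      calc (2 : ℝ) ^ (3 - α) ≤ 2 ^ (3 : ℝ) := rpow_le_rpow_of_exponent_le one_le_two (by linarith)
        _ = 8 := by norm_num
    have h2 : d ^ (3 - α) = d ^ 2 * d ^ (1 - α) := by
      rw [show 3 - α = 2 + (1 - α) by ring, rpow_add hd0, rpow_two]
    rw [mul_rpow zero_le_two hd0.le, h2]
    have h3 : 0 < 1 / (1 - α) := by
      have : 0 < 1 - α := by linarith
      positivity
    calc 1 / (1 - α) * (2 ^ (3 - α) * (d ^ 2 * d ^ (1 - α)))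
        ≤ 1 / (1 - α) * (4 * π * (d ^ 2 * d ^ (1 - α))) := by
          gcongr
          linarith [pi_gt_three]
      _ = _ := by ring
  rw [← ENNReal.mul_le_mul_iff_right hvol0 hvolt]
  calc _ ≤ _ := hmain
    _ = ENNReal.ofReal (1 / (1 - α)) * ENNReal.ofReal (2 * d) ^ (3 - α) *
        (rieszPot α g x + rieszPot α g y) := by ring
    _ ≤ _ := (mul_le_mul_left hconst _).trans_eq (by ring)

/-! ### Composition with holomorphic maps -/

section HolomorphicComposition

variable {V : Type*} [NormedAddCommGroup V] [NormedSpace ℝ V] {ι : ℂ →L[ℝ] V} {c : V}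
  {m : ℂ → ℂ} {Ω : Set ℂ} {D : Set V} {f g : V → ℝ}

lemma map_mul_one_eq (ι : ℂ →L[ℝ] V) (α : ℂ) :
    ι (α * 1) = α.re • ι 1 + α.im • ι Complex.I := by
  rw [← map_smul, ← map_smul, ← map_add]
  congr 1
  apply Complex.ext <;> simp

lemma map_mul_I_eq (ι : ℂ →L[ℝ] V) (α : ℂ) :
    ι (α * Complex.I) = -α.im • ι 1 + α.re • ι Complex.I := by
  rw [← map_smul, ← map_smul, ← map_add]
  congr 1
  apply Complex.ext <;> simp

lemma hasFDerivAt_add_comp_holomorphic (hΩ : IsOpen Ω) (hm : DifferentiableOn ℂ m Ω) {ζ : ℂ}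
    (hζ : ζ ∈ Ω) :
    HasFDerivAt (fun ζ => c + ι (m ζ))
      (ι.comp ((deriv m ζ) • ContinuousLinearMap.id ℝ ℂ)) ζ := by
  have h1 : HasDerivAt m (deriv m ζ) ζ := (hm.differentiableAt (hΩ.mem_nhds hζ)).hasDerivAt
  have h2 : HasFDerivAt m ((deriv m ζ) • ContinuousLinearMap.id ℝ ℂ) ζ := by
    refine h1.complexToReal_fderiv.congr_fderiv ?_
    ext v; simp
  exact (ι.hasFDerivAt.comp ζ h2).const_add c

lemma contDiffOn_comp_holomorphic (hΩ : IsOpen Ω) (hm : DifferentiableOn ℂ m Ω)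
    (hf : ContDiffOn ℝ 2 f D) (hmap : ∀ ζ ∈ Ω, c + ι (m ζ) ∈ D) :
    ContDiffOn ℝ 2 (fun ζ => f (c + ι (m ζ))) Ω := by
  have hmR : ContDiffOn ℝ 2 m Ω := (hm.contDiffOn hΩ).restrict_scalars ℝ
  exact hf.comp (contDiffOn_const.add (ι.contDiff.comp_contDiffOn hmR)) hmap

lemma fderiv_comp_holomorphic (hΩ : IsOpen Ω) (hm : DifferentiableOn ℂ m Ω) (hD : IsOpen D)
    (hf : ContDiffOn ℝ 2 f D) (hmap : ∀ ζ ∈ Ω, c + ι (m ζ) ∈ D) {ζ : ℂ} (hζ : ζ ∈ Ω) (v : ℂ) :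
    fderiv ℝ (fun ζ => f (c + ι (m ζ))) ζ v = fderiv ℝ f (c + ι (m ζ)) (ι (deriv m ζ * v)) := by
  have hd : DifferentiableAt ℝ f (c + ι (m ζ)) :=
    (hf.differentiableOn two_ne_zero).differentiableAt (hD.mem_nhds (hmap ζ hζ))
  have := hd.hasFDerivAt.comp ζ (hasFDerivAt_add_comp_holomorphic hΩ hm hζ)
  rw [show (fun ζ => f (c + ι (m ζ))) = f ∘ fun ζ => c + ι (m ζ) from rfl, this.fderiv]
  simp

lemma jacobian_comp_holomorphic (hΩ : IsOpen Ω) (hm : DifferentiableOn ℂ m Ω) (hD : IsOpen D)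
    (hf : ContDiffOn ℝ 2 f D) (hg : ContDiffOn ℝ 2 g D) (hmap : ∀ ζ ∈ Ω, c + ι (m ζ) ∈ D)
    {ζ : ℂ} (hζ : ζ ∈ Ω) :
    fderiv ℝ (fun ζ => f (c + ι (m ζ))) ζ 1 * fderiv ℝ (fun ζ => g (c + ι (m ζ))) ζ Complex.I -
      fderiv ℝ (fun ζ => f (c + ι (m ζ))) ζ Complex.I * fderiv ℝ (fun ζ => g (c + ι (m ζ))) ζ 1 =
    ‖deriv m ζ‖ ^ 2 *
      (fderiv ℝ f (c + ι (m ζ)) (ι 1) * fderiv ℝ g (c + ι (m ζ)) (ι Complex.I) -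
        fderiv ℝ f (c + ι (m ζ)) (ι Complex.I) * fderiv ℝ g (c + ι (m ζ)) (ι 1)) := by
  simp only [fderiv_comp_holomorphic hΩ hm hD hf hmap hζ,
    fderiv_comp_holomorphic hΩ hm hD hg hmap hζ]
  set α := deriv m ζ
  rw [map_mul_one_eq, map_mul_I_eq, Complex.sq_norm, Complex.normSq_apply]
  simp only [map_add, map_smul, smul_eq_mul]
  ring

lemma laplacian_comp_holomorphic (hΩ : IsOpen Ω) (hm : DifferentiableOn ℂ m Ω) (hD : IsOpen D)
    (hf : ContDiffOn ℝ 2 f D) (hmap : ∀ ζ ∈ Ω, c + ι (m ζ) ∈ D) {ζ : ℂ} (hζ : ζ ∈ Ω) :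
    fderiv ℝ (fderiv ℝ fun ζ => f (c + ι (m ζ))) ζ 1 1 +
      fderiv ℝ (fderiv ℝ fun ζ => f (c + ι (m ζ))) ζ Complex.I Complex.I =
    ‖deriv m ζ‖ ^ 2 * (fderiv ℝ (fderiv ℝ f) (c + ι (m ζ)) (ι 1) (ι 1) +
      fderiv ℝ (fderiv ℝ f) (c + ι (m ζ)) (ι Complex.I) (ι Complex.I)) := by
  set F : ℂ → ℝ := fun ζ => f (c + ι (m ζ)) with hF
  have hFC : ContDiffOn ℝ 2 F Ω := contDiffOn_comp_holomorphic hΩ hm hf hmap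
  have hF' : DifferentiableAt ℝ (fderiv ℝ F) ζ :=
    ((hFC.fderiv_of_isOpen hΩ (m := 1) (by norm_num)).differentiableOn
      one_ne_zero).differentiableAt (hΩ.mem_nhds hζ)
  have hf' : DifferentiableAt ℝ (fderiv ℝ f) (c + ι (m ζ)) :=
    ((hf.fderiv_of_isOpen hD (m := 1) (by norm_num)).differentiableOn
      one_ne_zero).differentiableAt (hD.mem_nhds (hmap ζ hζ))
  have hm' : HasDerivAt (deriv m) (deriv (deriv m) ζ) ζ :=
    ((hm.deriv hΩ).differentiableAt (hΩ.mem_nhds hζ)).hasDerivAt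
  have hm'' : HasFDerivAt (deriv m) ((deriv (deriv m) ζ) • ContinuousLinearMap.id ℝ ℂ) ζ := by
    refine hm'.complexToReal_fderiv.congr_fderiv ?_
    ext v; simp
  set α := deriv m ζ with hα
  set Q := fderiv ℝ (fderiv ℝ f) (c + ι (m ζ)) with hQ
  have hsecond : ∀ v : ℂ, fderiv ℝ (fderiv ℝ F) ζ v v = Q (ι (α * v)) (ι (α * v)) +
      fderiv ℝ f (c + ι (m ζ)) (ι (deriv (deriv m) ζ * (v * v))) := by
    intro v
    have h1 : HasFDerivAt (fun w => fderiv ℝ F w v) ((fderiv ℝ (fderiv ℝ F) ζ).flip v) ζ := by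
      refine (hF'.hasFDerivAt.clm_apply (hasFDerivAt_const v ζ)).congr_fderiv ?_
      ext; simp
    have h2 : HasFDerivAt (fun w => fderiv ℝ f (c + ι (m w)) (ι (deriv m w * v))) _ ζ :=
      (hf'.hasFDerivAt.comp ζ (hasFDerivAt_add_comp_holomorphic hΩ hm hζ)).clm_apply
        (ι.hasFDerivAt.comp ζ (hm''.mul_const v))
    have h3 : (fun w => fderiv ℝ F w v) =ᶠ[nhds ζ]
        fun w => fderiv ℝ f (c + ι (m w)) (ι (deriv m w * v)) := by
      filter_upwards [hΩ.mem_nhds hζ] with w hw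
      exact fderiv_comp_holomorphic hΩ hm hD hf hmap hw v
    have h4 := congrArg (fun T => T v) (h1.unique (h2.congr_of_eventuallyEq h3))
    simp only [ContinuousLinearMap.flip_apply] at h4
    rw [h4]
    simp [hα, hQ, mul_comm, mul_left_comm, add_comm]
  rw [hsecond, hsecond, Complex.I_mul_I]
  have h3 : ι (deriv (deriv m) ζ * -1) = - ι (deriv (deriv m) ζ * (1 * 1)) := by
    rw [← map_neg]
    congr 1
    ring
  rw [map_mul_one_eq, map_mul_I_eq, h3, Complex.sq_norm, Complex.normSq_apply]
  simp only [map_add, map_smul, map_neg, smul_eq_mul, add_apply, smul_apply]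
  ring

end HolomorphicComposition

lemma det_smul_id_complex (α : ℂ) :
    (α • ContinuousLinearMap.id ℝ ℂ).det = ‖α‖ ^ 2 := by
  rw [ContinuousLinearMap.det, ← LinearMap.det_toMatrix Complex.basisOneI, Matrix.det_fin_two,
    Complex.sq_norm, Complex.normSq_apply]
  simp [LinearMap.toMatrix_apply]

lemma setLIntegral_image_holomorphic {m : ℂ → ℂ} {Ω S : Set ℂ} (hΩ : IsOpen Ω)
    (hm : DifferentiableOn ℂ m Ω) (hS : MeasurableSet S) (hSΩ : S ⊆ Ω) (hinj : Set.InjOn m S)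
    (H : ℂ → ℝ≥0∞) :
    ∫⁻ y in m '' S, H y = ∫⁻ ζ in S, ‖deriv m ζ‖ₑ ^ 2 * H (m ζ) := by
  rw [lintegral_image_eq_lintegral_abs_det_fderiv_mul volume hS
    (f' := fun ζ => deriv m ζ • ContinuousLinearMap.id ℝ ℂ) _ hinj]
  · refine lintegral_congr fun ζ => ?_
    rw [det_smul_id_complex, abs_of_nonneg (by positivity), ENNReal.ofReal_pow (norm_nonneg _),
      ofReal_norm]
  · intro ζ hζ
    have := hasFDerivAt_add_comp_holomorphic (ι := ContinuousLinearMap.id ℝ ℂ) (c := 0) hΩ hm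
      (hSΩ hζ)
    simpa using this.hasFDerivWithinAt

/-! ### A flux identity on a half strip -/

/-- In the coordinate `ζ = log y`, the real part of `1 / y` corrected so as to vanish
on `Re ζ = R`. -/
def stripWeight (R : ℝ) (ζ : ℂ) : ℝ :=
  (exp (-ζ.re) - exp (ζ.re - 2 * R)) * cos ζ.im

/-- The harmonic conjugate of `stripWeight R`. -/
def stripConj (R : ℝ) (ζ : ℂ) : ℝ :=
  -(exp (-ζ.re) + exp (ζ.re - 2 * R)) * sin ζ.im

/-- The derivative of `stripWeight R` in the imaginary direction. -/
def stripWeightIm (R : ℝ) (ζ : ℂ) : ℝ :=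
  -(exp (-ζ.re) - exp (ζ.re - 2 * R)) * sin ζ.im

/-- The derivative of `stripWeight R` in the real direction. -/
def stripWeightRe (R : ℝ) (ζ : ℂ) : ℝ :=
  -(exp (-ζ.re) + exp (ζ.re - 2 * R)) * cos ζ.im

lemma hasFDerivAt_stripWeight (R : ℝ) (ζ : ℂ) :
    HasFDerivAt (stripWeight R)
      (stripWeightRe R ζ • Complex.reCLM + stripWeightIm R ζ • Complex.imCLM) ζ := by
  have hre : HasFDerivAt (fun ζ : ℂ => ζ.re) Complex.reCLM ζ := Complex.reCLM.hasFDerivAt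
  have him : HasFDerivAt (fun ζ : ℂ => ζ.im) Complex.imCLM ζ := Complex.imCLM.hasFDerivAt
  refine ((hre.neg.exp.sub (hre.sub_const (2 * R)).exp).mul him.cos).congr_fderiv ?_
  ext v
  simp [stripWeightRe, stripWeightIm]
  ring

lemma hasFDerivAt_stripConj (R : ℝ) (ζ : ℂ) :
    HasFDerivAt (stripConj R)
      (-stripWeightIm R ζ • Complex.reCLM + stripWeightRe R ζ • Complex.imCLM) ζ := by
  have hre : HasFDerivAt (fun ζ : ℂ => ζ.re) Complex.reCLM ζ := Complex.reCLM.hasFDerivAt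
  have him : HasFDerivAt (fun ζ : ℂ => ζ.im) Complex.imCLM ζ := Complex.imCLM.hasFDerivAt
  refine ((hre.neg.exp.add (hre.sub_const (2 * R)).exp).neg.mul him.sin).congr_fderiv ?_
  ext v
  simp [stripWeightRe, stripWeightIm]
  ring

/-- The flux through vertical lines. -/
def fluxRe (R b₀ : ℝ) (U A B : ℂ → ℝ) (ζ : ℂ) : ℝ :=
  stripWeight R ζ * fderiv ℝ U ζ 1 + stripConj R ζ * fderiv ℝ U ζ Complex.I +
    stripWeight R ζ * ((B ζ - b₀) * fderiv ℝ A ζ Complex.I)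

/-- The flux through horizontal lines. -/
def fluxIm (R b₀ : ℝ) (U A B : ℂ → ℝ) (ζ : ℂ) : ℝ :=
  stripWeight R ζ * fderiv ℝ U ζ Complex.I - stripConj R ζ * fderiv ℝ U ζ 1 -
    stripWeight R ζ * ((B ζ - b₀) * fderiv ℝ A ζ 1)

/-- The divergence of the flux. -/
def fluxDiv (R b₀ : ℝ) (A B : ℂ → ℝ) (ζ : ℂ) : ℝ :=
  (B ζ - b₀) * (stripWeightRe R ζ * fderiv ℝ A ζ Complex.I -
    stripWeightIm R ζ * fderiv ℝ A ζ 1)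

lemma continuous_stripWeightRe (R : ℝ) : Continuous (stripWeightRe R) := by
  unfold stripWeightRe
  fun_prop

lemma continuous_stripWeightIm (R : ℝ) : Continuous (stripWeightIm R) := by
  unfold stripWeightIm
  fun_prop

section Flux

variable {Ω : Set ℂ} {U A B : ℂ → ℝ}

lemma hasFDerivAt_fderiv_apply (hΩ : IsOpen Ω) (hU : ContDiffOn ℝ 2 U Ω) {ζ : ℂ} (hζ : ζ ∈ Ω)
    (v : ℂ) :
    HasFDerivAt (fun w => fderiv ℝ U w v) ((fderiv ℝ (fderiv ℝ U) ζ).flip v) ζ := by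
  have h : DifferentiableAt ℝ (fderiv ℝ U) ζ :=
    ((hU.fderiv_of_isOpen hΩ (m := 1) (by norm_num)).differentiableOn
      one_ne_zero).differentiableAt (hΩ.mem_nhds hζ)
  refine (h.hasFDerivAt.clm_apply (hasFDerivAt_const v ζ)).congr_fderiv ?_
  ext; simp

lemma continuousOn_fderiv_apply (hΩ : IsOpen Ω) (hU : ContDiffOn ℝ 2 U Ω) (v : ℂ) :
    ContinuousOn (fun w => fderiv ℝ U w v) Ω :=
  (hU.continuousOn_fderiv_of_isOpen hΩ one_le_two).clm_apply continuousOn_const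

lemma fderiv_fderiv_comm (hΩ : IsOpen Ω) (hU : ContDiffOn ℝ 2 U Ω) {ζ : ℂ} (hζ : ζ ∈ Ω)
    (v w : ℂ) : fderiv ℝ (fderiv ℝ U) ζ v w = fderiv ℝ (fderiv ℝ U) ζ w v :=
  ((hU.contDiffAt (hΩ.mem_nhds hζ)).isSymmSndFDerivAt (by simp)).eq v w

lemma exists_hasFDerivAt_flux (hΩ : IsOpen Ω) (hU : ContDiffOn ℝ 2 U Ω) (hA : ContDiffOn ℝ 2 A Ω)
    (hB : ContDiffOn ℝ 2 B Ω) {ζ : ℂ} (hζ : ζ ∈ Ω)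
    (heq : fderiv ℝ (fderiv ℝ U) ζ 1 1 + fderiv ℝ (fderiv ℝ U) ζ Complex.I Complex.I =
      fderiv ℝ A ζ 1 * fderiv ℝ B ζ Complex.I - fderiv ℝ A ζ Complex.I * fderiv ℝ B ζ 1)
    (R b₀ : ℝ) :
    HasFDerivAt (fluxRe R b₀ U A B) (fderiv ℝ (fluxRe R b₀ U A B) ζ) ζ ∧
    HasFDerivAt (fluxIm R b₀ U A B) (fderiv ℝ (fluxIm R b₀ U A B) ζ) ζ ∧
    fderiv ℝ (fluxRe R b₀ U A B) ζ 1 + fderiv ℝ (fluxIm R b₀ U A B) ζ Complex.I =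
      fluxDiv R b₀ A B ζ := by
  have hW := hasFDerivAt_stripWeight R ζ
  have hW' := hasFDerivAt_stripConj R ζ
  have hBd : HasFDerivAt (fun ζ => B ζ - b₀) (fderiv ℝ B ζ) ζ :=
    ((hB.differentiableOn two_ne_zero).differentiableAt (hΩ.mem_nhds hζ)).hasFDerivAt.sub_const b₀
  have hU1 := hasFDerivAt_fderiv_apply hΩ hU hζ 1
  have hUI := hasFDerivAt_fderiv_apply hΩ hU hζ Complex.I
  have hA1 := hasFDerivAt_fderiv_apply hΩ hA hζ 1
  have hAI := hasFDerivAt_fderiv_apply hΩ hA hζ Complex.I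
  have h1 : HasFDerivAt (fluxRe R b₀ U A B) _ ζ :=
    ((hW.mul hU1).add (hW'.mul hUI)).add (hW.mul (hBd.mul hAI))
  have h2 : HasFDerivAt (fluxIm R b₀ U A B) _ ζ :=
    ((hW.mul hUI).sub (hW'.mul hU1)).sub (hW.mul (hBd.mul hA1))
  refine ⟨h1.differentiableAt.hasFDerivAt, h2.differentiableAt.hasFDerivAt, ?_⟩
  rw [h1.fderiv, h2.fderiv]
  simp [fluxDiv]
  rw [fderiv_fderiv_comm hΩ hU hζ Complex.I 1, fderiv_fderiv_comm hΩ hA hζ Complex.I 1]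
  linear_combination stripWeight R ζ * heq

lemma continuousOn_fluxDiv (hΩ : IsOpen Ω) (hA : ContDiffOn ℝ 2 A Ω) (hB : ContDiffOn ℝ 2 B Ω)
    (R b₀ : ℝ) : ContinuousOn (fluxDiv R b₀ A B) Ω :=
  (hB.continuousOn.sub continuousOn_const).mul
    (((continuous_stripWeightRe R).continuousOn.mul (continuousOn_fderiv_apply hΩ hA _)).sub
      ((continuous_stripWeightIm R).continuousOn.mul (continuousOn_fderiv_apply hΩ hA _)))

lemma flux_identity (hΩ : IsOpen Ω) (hU : ContDiffOn ℝ 2 U Ω) (hA : ContDiffOn ℝ 2 A Ω)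
    (hB : ContDiffOn ℝ 2 B Ω)
    (heq : ∀ ζ ∈ Ω, fderiv ℝ (fderiv ℝ U) ζ 1 1 + fderiv ℝ (fderiv ℝ U) ζ Complex.I Complex.I =
      fderiv ℝ A ζ 1 * fderiv ℝ B ζ Complex.I - fderiv ℝ A ζ Complex.I * fderiv ℝ B ζ 1)
    (hUp : ∀ ζ, U (ζ + 2 * π * Complex.I) = U ζ) (hAp : ∀ ζ, A (ζ + 2 * π * Complex.I) = A ζ)
    (hBp : ∀ ζ, B (ζ + 2 * π * Complex.I) = B ζ) {s R : ℝ} (hsR : s ≤ R)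
    (hmem : ∀ ζ : ℂ, ζ.re ≤ R → ζ ∈ Ω) (b₀ : ℝ) :
    (∫ θ in -π..π, fluxRe R b₀ U A B (R + θ * Complex.I)) -
      ∫ θ in -π..π, fluxRe R b₀ U A B (s + θ * Complex.I) =
    ∫ t in s..R, ∫ θ in -π..π, fluxDiv R b₀ A B (t + θ * Complex.I) := by
  set e : ℝ × ℝ →L[ℝ] ℂ := (Complex.equivRealProdCLM.symm : ℝ × ℝ →L[ℝ] ℂ) with he
  have heapp : ∀ t θ : ℝ, e (t, θ) = t + θ * Complex.I := fun t θ => by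
    apply Complex.ext <;> simp [he]
  have hepre : ∀ z : ℝ × ℝ, (e z).re = z.1 := fun z => by simp [he]
  have hbox : ∀ z ∈ Set.uIcc s R ×ˢ Set.uIcc (-π) π, e z ∈ Ω := by
    intro z hz
    rw [Set.uIcc_of_le hsR] at hz
    exact hmem _ (by rw [hepre]; exact hz.1.2)
  have hfl := fun z (hz : z ∈ Set.uIcc s R ×ˢ Set.uIcc (-π) π) =>
    exists_hasFDerivAt_flux hΩ hU hA hB (hbox z hz) (heq _ (hbox z hz)) R b₀
  have h1 : ∀ z ∈ Set.uIcc s R ×ˢ Set.uIcc (-π) π, HasFDerivAt (fun z => fluxRe R b₀ U A B (e z))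
      ((fderiv ℝ (fluxRe R b₀ U A B) (e z)).comp e) z :=
    fun z hz => (hfl z hz).1.comp z e.hasFDerivAt
  have h2 : ∀ z ∈ Set.uIcc s R ×ˢ Set.uIcc (-π) π, HasFDerivAt (fun z => fluxIm R b₀ U A B (e z))
      ((fderiv ℝ (fluxIm R b₀ U A B) (e z)).comp e) z :=
    fun z hz => (hfl z hz).2.1.comp z e.hasFDerivAt
  have hdiv : ∀ z ∈ Set.uIcc s R ×ˢ Set.uIcc (-π) π,
      ((fderiv ℝ (fluxRe R b₀ U A B) (e z)).comp e) (1, 0) +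
        ((fderiv ℝ (fluxIm R b₀ U A B) (e z)).comp e) (0, 1) = fluxDiv R b₀ A B (e z) := by
    intro z hz
    rw [← (hfl z hz).2.2]
    simp [heapp]
  have hsub : Set.Ioo (min s R) (max s R) ×ˢ Set.Ioo (min (-π) π) (max (-π) π) ⊆
      Set.uIcc s R ×ˢ Set.uIcc (-π) π :=
    Set.prod_mono Set.Ioo_subset_Icc_self Set.Ioo_subset_Icc_self
  have hcont : ContinuousOn (fun z => fluxDiv R b₀ A B (e z))
      (Set.uIcc s R ×ˢ Set.uIcc (-π) π) :=
    (continuousOn_fluxDiv hΩ hA hB R b₀).comp e.continuous.continuousOn hbox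
  have key := integral2_divergence_prod_of_hasFDerivAt_off_countable
    (fun z => fluxRe R b₀ U A B (e z)) (fun z => fluxIm R b₀ U A B (e z))
    (fun z => (fderiv ℝ (fluxRe R b₀ U A B) (e z)).comp e)
    (fun z => (fderiv ℝ (fluxIm R b₀ U A B) (e z)).comp e) s (-π) R π ∅ Set.countable_empty
    (fun z hz => (h1 z hz).continuousAt.continuousWithinAt)
    (fun z hz => (h2 z hz).continuousAt.continuousWithinAt)
    (fun z hz => h1 z (hsub hz.1)) (fun z hz => h2 z (hsub hz.1))
    ((hcont.integrableOn_compact (isCompact_uIcc.prod isCompact_uIcc)).congr_fun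
      (fun z hz => (hdiv z hz).symm) (measurableSet_uIcc.prod measurableSet_uIcc))
  have hper : ∀ t : ℝ, fluxIm R b₀ U A B (e (t, π)) = fluxIm R b₀ U A B (e (t, -π)) := by
    intro t
    have hshift : (t + (π : ℝ) * Complex.I : ℂ) = (t + (-π : ℝ) * Complex.I) + 2 * π * Complex.I := by
      push_cast
      ring
    have hdp : ∀ F : ℂ → ℝ, (∀ ζ, F (ζ + 2 * π * Complex.I) = F ζ) →
        ∀ ζ, fderiv ℝ F (ζ + 2 * π * Complex.I) = fderiv ℝ F ζ := by
      intro F hF ζ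
      rw [← fderiv_comp_add_right]
      simp only [hF]
    rw [heapp, heapp, hshift]
    simp only [fluxIm, hdp U hUp, hdp A hAp, hBp, stripWeight, stripConj]
    simp
  have hinner : ∀ t ∈ Set.uIcc s R, (∫ θ in -π..π,
      (((fderiv ℝ (fluxRe R b₀ U A B) (e (t, θ))).comp e) (1, 0) +
        ((fderiv ℝ (fluxIm R b₀ U A B) (e (t, θ))).comp e) (0, 1))) =
      ∫ θ in -π..π, fluxDiv R b₀ A B (t + θ * Complex.I) := by
    intro t ht
    refine intervalIntegral.integral_congr fun θ hθ => ?_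
    rw [← heapp]
    exact hdiv (t, θ) ⟨ht, hθ⟩
  rw [intervalIntegral.integral_congr hinner] at key
  rw [key]
  simp only [hper]
  simp only [heapp]
  ring

end Flux

/-! ### A gradient bound at the centre of the unit disc -/

section Centre

open Filter Topology

lemma exp_mem_unitBall {ζ : ℂ} (hζ : ζ.re < 0) : Complex.exp ζ ∈ ball (0 : ℂ) 1 := by
  rw [mem_ball_zero_iff, Complex.norm_exp]
  exact Real.exp_lt_one_iff.2 hζ

lemma isOpen_re_neg : IsOpen {ζ : ℂ | ζ.re < 0} :=
  isOpen_lt Complex.continuous_re continuous_const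

lemma contDiffOn_comp_exp {f : ℂ → ℝ} (hf : ContDiffOn ℝ 2 f (ball 0 1)) :
    ContDiffOn ℝ 2 (fun ζ => f (Complex.exp ζ)) {ζ : ℂ | ζ.re < 0} := by
  simpa using contDiffOn_comp_holomorphic (ι := ContinuousLinearMap.id ℝ ℂ) (c := 0)
    isOpen_re_neg Complex.differentiable_exp.differentiableOn hf
    (fun ζ hζ => by simpa using exp_mem_unitBall hζ)

lemma fderiv_comp_exp {f : ℂ → ℝ} (hf : ContDiffOn ℝ 2 f (ball 0 1)) {ζ : ℂ} (hζ : ζ.re < 0)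
    (v : ℂ) : fderiv ℝ (fun ζ => f (Complex.exp ζ)) ζ v =
      fderiv ℝ f (Complex.exp ζ) (Complex.exp ζ * v) := by
  simpa using fderiv_comp_holomorphic (ι := ContinuousLinearMap.id ℝ ℂ) (c := 0)
    isOpen_re_neg Complex.differentiable_exp.differentiableOn isOpen_ball hf
    (fun ζ hζ => by simpa using exp_mem_unitBall hζ) hζ v

lemma laplacian_comp_exp {a b φ : ℂ → ℝ} (ha : ContDiffOn ℝ 2 a (ball 0 1))
    (hb : ContDiffOn ℝ 2 b (ball 0 1)) (hφ : ContDiffOn ℝ 2 φ (ball 0 1))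
    (heq : ∀ y ∈ ball (0 : ℂ) 1,
      fderiv ℝ (fderiv ℝ φ) y 1 1 + fderiv ℝ (fderiv ℝ φ) y Complex.I Complex.I =
      fderiv ℝ a y 1 * fderiv ℝ b y Complex.I - fderiv ℝ a y Complex.I * fderiv ℝ b y 1)
    {ζ : ℂ} (hζ : ζ.re < 0) :
    fderiv ℝ (fderiv ℝ fun ζ => φ (Complex.exp ζ)) ζ 1 1 +
      fderiv ℝ (fderiv ℝ fun ζ => φ (Complex.exp ζ)) ζ Complex.I Complex.I =
    fderiv ℝ (fun ζ => a (Complex.exp ζ)) ζ 1 *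
        fderiv ℝ (fun ζ => b (Complex.exp ζ)) ζ Complex.I -
      fderiv ℝ (fun ζ => a (Complex.exp ζ)) ζ Complex.I *
        fderiv ℝ (fun ζ => b (Complex.exp ζ)) ζ 1 := by
  have hmap : ∀ ζ ∈ {ζ : ℂ | ζ.re < 0},
      0 + ContinuousLinearMap.id ℝ ℂ (Complex.exp ζ) ∈ ball (0 : ℂ) 1 :=
    fun ζ hζ => by simpa using exp_mem_unitBall hζ
  have h1 := laplacian_comp_holomorphic isOpen_re_neg
    Complex.differentiable_exp.differentiableOn isOpen_ball hφ hmap hζ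
  have h2 := jacobian_comp_holomorphic isOpen_re_neg
    Complex.differentiable_exp.differentiableOn isOpen_ball ha hb hmap hζ
  have h3 := heq _ (exp_mem_unitBall hζ)
  simp only [ContinuousLinearMap.id_apply, zero_add] at h1 h2
  rw [h1, h2, h3]

lemma abs_fluxDiv_comp_exp_le {a b : ℂ → ℝ} (ha : ContDiffOn ℝ 2 a (ball 0 1)) {R : ℝ} (hR : R < 0)
    (b₀ : ℝ) {ζ : ℂ} (hζ : ζ.re ≤ R) :
    ‖fluxDiv R b₀ (fun ζ => a (Complex.exp ζ)) (fun ζ => b (Complex.exp ζ)) ζ‖ ≤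
      3 * (‖fderiv ℝ a (Complex.exp ζ)‖ * ‖b (Complex.exp ζ) - b₀‖) := by
  have hζ0 : ζ.re < 0 := hζ.trans_lt hR
  have hv : ∀ v : ℂ, ‖v‖ = 1 → |fderiv ℝ (fun ζ => a (Complex.exp ζ)) ζ v| ≤
      ‖fderiv ℝ a (Complex.exp ζ)‖ * exp ζ.re := by
    intro v hv
    rw [fderiv_comp_exp ha hζ0]
    refine ((fderiv ℝ a (Complex.exp ζ)).le_opNorm _).trans_eq ?_
    rw [norm_mul, hv, mul_one, Complex.norm_exp]
  have h1 := hv 1 norm_one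
  have hI := hv Complex.I Complex.norm_I
  have he : exp (ζ.re - 2 * R) ≤ exp (-ζ.re) := exp_le_exp.2 (by linarith)
  have he0 := exp_pos (ζ.re - 2 * R)
  have hee : exp (-ζ.re) * exp ζ.re = 1 := by rw [← exp_add]; simp
  have hWre : |stripWeightRe R ζ| ≤ 2 * exp (-ζ.re) := by
    rw [stripWeightRe, abs_mul, abs_neg, abs_of_pos (by positivity)]
    exact (mul_le_of_le_one_right (by positivity) (abs_cos_le_one _)).trans (by linarith)
  have hWim : |stripWeightIm R ζ| ≤ exp (-ζ.re) := by
    rw [stripWeightIm, abs_mul, abs_neg, abs_of_nonneg (by linarith)]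
    exact (mul_le_of_le_one_right (by linarith) (abs_sin_le_one _)).trans (by linarith)
  rw [fluxDiv, norm_mul, mul_comm, ← mul_assoc]
  refine mul_le_mul_of_nonneg_right ?_ (norm_nonneg _)
  refine (norm_sub_le _ _).trans ?_
  rw [norm_mul, norm_mul]
  simp only [Real.norm_eq_abs]
  calc _ ≤ 2 * exp (-ζ.re) * (‖fderiv ℝ a (Complex.exp ζ)‖ * exp ζ.re) +
        exp (-ζ.re) * (‖fderiv ℝ a (Complex.exp ζ)‖ * exp ζ.re) := by gcongr
    _ = 3 * ‖fderiv ℝ a (Complex.exp ζ)‖ * (exp (-ζ.re) * exp ζ.re) := by ring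
    _ = _ := by rw [hee, mul_one]

lemma setLIntegral_preimage_re_add_im_mul_I (H : ℂ → ℝ≥0∞) (S : Set ℂ) :
    ∫⁻ z in (fun z : ℝ × ℝ => (z.1 + z.2 * Complex.I : ℂ)) ⁻¹' S, H (z.1 + z.2 * Complex.I) =
      ∫⁻ ζ in S, H ζ := by
  have h : (fun z : ℝ × ℝ => (z.1 + z.2 * Complex.I : ℂ)) =
      Complex.measurableEquivRealProd.symm := by
    ext z
    simp [Complex.measurableEquivRealProd, Complex.ext_iff]
  have := Complex.volume_preserving_equiv_real_prod.symm.setLIntegral_comp_preimage_emb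
    Complex.measurableEquivRealProd.symm.measurableEmbedding H S
  rw [← h] at this
  exact this

lemma enorm_integral_fluxDiv_le {a b : ℂ → ℝ} (ha : ContDiffOn ℝ 2 a (ball 0 1))
    (hb : ContDiffOn ℝ 2 b (ball 0 1)) {s R : ℝ} (hsR : s ≤ R) (hR : R < 0) (b₀ : ℝ) :
    ‖∫ t in s..R, ∫ θ in -π..π, fluxDiv R b₀ (fun ζ => a (Complex.exp ζ))
      (fun ζ => b (Complex.exp ζ)) (t + θ * Complex.I)‖ₑ ≤
    3 * ∫⁻ y in ball (0 : ℂ) 1, ‖fderiv ℝ a y‖ₑ * ‖b y - b₀‖ₑ / ‖y‖ₑ ^ 2 := by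
  set F := fluxDiv R b₀ (fun ζ => a (Complex.exp ζ)) (fun ζ => b (Complex.exp ζ)) with hF
  set H : ℂ → ℝ≥0∞ := fun y => ‖fderiv ℝ a y‖ₑ * ‖b y - b₀‖ₑ / ‖y‖ₑ ^ 2 with hH
  have hFc : ContinuousOn F {ζ : ℂ | ζ.re < 0} :=
    continuousOn_fluxDiv isOpen_re_neg (contDiffOn_comp_exp ha) (contDiffOn_comp_exp hb) R b₀
  set S : Set ℂ := {ζ | ζ.re ∈ Set.Ioc s R ∧ ζ.im ∈ Set.Ioc (-π) π} with hS
  have hSm : MeasurableSet S :=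
    (Complex.measurable_re measurableSet_Ioc).inter (Complex.measurable_im measurableSet_Ioc)
  have hSΩ : S ⊆ {ζ : ℂ | ζ.re < 0} := fun ζ hζ => hζ.1.2.trans_lt hR
  have hpi : -π ≤ π := by linarith [pi_pos]
  have hpre : (fun z : ℝ × ℝ => (z.1 + z.2 * Complex.I : ℂ)) ⁻¹' S =
      Set.Ioc s R ×ˢ Set.Ioc (-π) π := by
    ext z
    simp [hS]
  have hcp : ContinuousOn (fun z : ℝ × ℝ => ‖F (z.1 + z.2 * Complex.I)‖ₑ)
      (Set.Ioc s R ×ˢ Set.Ioc (-π) π) := by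
    refine ContinuousOn.enorm (hFc.comp (by fun_prop) ?_)
    intro z hz
    simpa using hz.1.2.trans_lt hR
  calc _ ≤ ∫⁻ t in Set.Ioc s R, ∫⁻ θ in Set.Ioc (-π) π, ‖F (t + θ * Complex.I)‖ₑ := by
        rw [intervalIntegral.integral_of_le hsR]
        refine (enorm_integral_le_lintegral_enorm _).trans (lintegral_mono fun t => ?_)
        rw [intervalIntegral.integral_of_le hpi]
        exact enorm_integral_le_lintegral_enorm _
    _ = ∫⁻ z in Set.Ioc s R ×ˢ Set.Ioc (-π) π, ‖F (z.1 + z.2 * Complex.I)‖ₑ := by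
        have := hcp.aemeasurable (μ := volume) (measurableSet_Ioc.prod measurableSet_Ioc)
        rw [Measure.volume_eq_prod, ← Measure.prod_restrict] at this ⊢
        rw [lintegral_prod _ this]
    _ ≤ ∫⁻ z in Set.Ioc s R ×ˢ Set.Ioc (-π) π,
          3 * (‖deriv Complex.exp (z.1 + z.2 * Complex.I)‖ₑ ^ 2 *
            H (Complex.exp (z.1 + z.2 * Complex.I))) := by
        refine setLIntegral_mono' (measurableSet_Ioc.prod measurableSet_Ioc) fun z hz => ?_
        set ζ : ℂ := z.1 + z.2 * Complex.I with hζ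
        have hre : ζ.re ≤ R := by simpa [hζ] using hz.1.2
        have hne : ‖Complex.exp ζ‖ₑ ^ 2 ≠ 0 := by simp
        have hnt : ‖Complex.exp ζ‖ₑ ^ 2 ≠ ⊤ := by simp
        rw [Complex.deriv_exp, hH]
        dsimp only
        rw [ENNReal.mul_div_cancel hne hnt]
        have := abs_fluxDiv_comp_exp_le (b := b) ha hR b₀ hre
        rw [← ofReal_norm, ← ofReal_norm, ← ofReal_norm, ← ENNReal.ofReal_mul (norm_nonneg _),
          ← ENNReal.ofReal_ofNat 3, ← ENNReal.ofReal_mul (by norm_num)]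
        exact ENNReal.ofReal_le_ofReal this
    _ = 3 * ∫⁻ z in Set.Ioc s R ×ˢ Set.Ioc (-π) π,
          (fun ζ => ‖deriv Complex.exp ζ‖ₑ ^ 2 * H (Complex.exp ζ)) (z.1 + z.2 * Complex.I) :=
        lintegral_const_mul' _ _ (by norm_num)
    _ = 3 * ∫⁻ ζ in S, ‖deriv Complex.exp ζ‖ₑ ^ 2 * H (Complex.exp ζ) := by
        rw [← hpre, setLIntegral_preimage_re_add_im_mul_I
          fun ζ => ‖deriv Complex.exp ζ‖ₑ ^ 2 * H (Complex.exp ζ)]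
    _ = 3 * ∫⁻ y in Complex.exp '' S, H y := by
        rw [setLIntegral_image_holomorphic isOpen_univ
          Complex.differentiable_exp.differentiableOn hSm (Set.subset_univ _)]
        exact fun x hx y hy h => Complex.exp_inj_of_neg_pi_lt_of_le_pi hx.2.1 hx.2.2 hy.2.1 hy.2.2 h
    _ ≤ _ := by
        gcongr
        rintro _ ⟨ζ, hζ, rfl⟩
        exact exp_mem_unitBall (hSΩ hζ)

lemma integral_fluxRe_edge {a b φ : ℂ → ℝ} (hφ : ContDiffOn ℝ 2 φ (ball 0 1)) {R : ℝ} (hR : R < 0)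
    (b₀ : ℝ) :
    ∫ θ in -π..π, fluxRe R b₀ (fun ζ => φ (Complex.exp ζ)) (fun ζ => a (Complex.exp ζ))
      (fun ζ => b (Complex.exp ζ)) (R + θ * Complex.I) =
    2 * exp (-R) * ∫ θ in -π..π, cos θ * φ (Complex.exp (R + θ * Complex.I)) := by
  set U : ℂ → ℝ := fun ζ => φ (Complex.exp ζ) with hU
  have hUC : ContDiffOn ℝ 2 U {ζ : ℂ | ζ.re < 0} := contDiffOn_comp_exp hφ
  have hmem : ∀ θ : ℝ, (R + θ * Complex.I : ℂ) ∈ {ζ : ℂ | ζ.re < 0} := fun θ => by simpa using hR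
  have hline : ∀ θ : ℝ, HasDerivAt (fun θ : ℝ => (R + θ * Complex.I : ℂ)) Complex.I θ := by
    intro θ
    simpa using (Complex.ofRealCLM.hasDerivAt.mul_const Complex.I).const_add (R : ℂ)
  have hder : ∀ θ : ℝ, HasDerivAt (fun θ : ℝ => U (R + θ * Complex.I))
      (fderiv ℝ U (R + θ * Complex.I) Complex.I) θ := fun θ =>
    ((hUC.differentiableOn two_ne_zero).differentiableAt
      (isOpen_re_neg.mem_nhds (hmem θ))).hasFDerivAt.comp_hasDerivAt (l := U) θ (hline θ)
  have hcont : Continuous fun θ : ℝ => fderiv ℝ U (R + θ * Complex.I) Complex.I :=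
    (continuousOn_fderiv_apply isOpen_re_neg hUC Complex.I).comp_continuous (by fun_prop) hmem
  have hparts := intervalIntegral.integral_mul_deriv_eq_deriv_mul (a := -π) (b := π)
    (fun θ _ => hasDerivAt_sin θ) (fun θ _ => hder θ)
    (continuous_cos.intervalIntegrable _ _) (hcont.intervalIntegrable _ _)
  simp only [sin_pi, sin_neg, neg_zero, zero_mul, sub_zero, zero_sub] at hparts
  have : ∀ θ : ℝ, fluxRe R b₀ U (fun ζ => a (Complex.exp ζ)) (fun ζ => b (Complex.exp ζ))
      (R + θ * Complex.I) =
      -(2 * exp (-R)) * (sin θ * fderiv ℝ U (R + θ * Complex.I) Complex.I) := by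
    intro θ
    simp only [fluxRe, stripWeight, stripConj]
    simp
    rw [show R - 2 * R = -R by ring]
    ring
  simp only [this]
  rw [intervalIntegral.integral_const_mul, hparts]
  ring

lemma tendsto_integral_edge {φ : ℂ → ℝ} (hφc : ContinuousOn φ (closedBall 0 1))
    (hφ0 : ∀ y ∈ sphere (0 : ℂ) 1, φ y = 0) :
    Tendsto (fun R : ℝ => 2 * exp (-R) * ∫ θ in -π..π, cos θ * φ (Complex.exp (R + θ * Complex.I)))
      (𝓝[<] 0) (𝓝 0) := by
  obtain ⟨C, hC⟩ := (isCompact_closedBall (0 : ℂ) 1).exists_bound_of_continuousOn hφc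
  have hmem : ∀ R : ℝ, R < 0 → ∀ θ : ℝ,
      Complex.exp (R + θ * Complex.I) ∈ closedBall (0 : ℂ) 1 := fun R hR θ =>
    ball_subset_closedBall (exp_mem_unitBall (by simpa using hR))
  have h1 : Tendsto (fun R : ℝ => ∫ θ in -π..π, cos θ * φ (Complex.exp (R + θ * Complex.I)))
      (𝓝[<] 0) (𝓝 (∫ θ in -π..π, (0 : ℝ))) := by
    refine intervalIntegral.tendsto_integral_filter_of_dominated_convergence (fun _ => C) ?_ ?_
      intervalIntegrable_const ?_
    · filter_upwards [self_mem_nhdsWithin] with R hR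
      refine Continuous.aestronglyMeasurable (continuous_cos.mul ?_)
      exact hφc.comp_continuous (by fun_prop) (hmem R hR)
    · filter_upwards [self_mem_nhdsWithin] with R hR
      refine ae_of_all _ fun θ _ => ?_
      rw [norm_mul]
      exact (mul_le_of_le_one_left (norm_nonneg _) (abs_cos_le_one θ)).trans (hC _ (hmem R hR θ))
    · refine ae_of_all _ fun θ _ => ?_
      have hs : Complex.exp ((0 : ℝ) + θ * Complex.I) ∈ sphere (0 : ℂ) 1 := by
        simp [Complex.norm_exp]
      have hcw := hφc _ (sphere_subset_closedBall hs)
      have ht : Tendsto (fun R : ℝ => Complex.exp (R + θ * Complex.I)) (𝓝[<] 0)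
          (𝓝[closedBall 0 1] (Complex.exp ((0 : ℝ) + θ * Complex.I))) := by
        refine tendsto_nhdsWithin_iff.2 ⟨?_, ?_⟩
        · exact ((by fun_prop : Continuous fun R : ℝ =>
            Complex.exp (R + θ * Complex.I)).tendsto 0).mono_left nhdsWithin_le_nhds
        · filter_upwards [self_mem_nhdsWithin] with R hR using hmem R hR θ
      have := (hcw.tendsto.comp ht).const_mul (cos θ)
      rwa [hφ0 _ hs, mul_zero] at this
  have h2 : Tendsto (fun R : ℝ => 2 * exp (-R)) (𝓝[<] 0) (𝓝 (2 * exp (-0))) :=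
    ((by fun_prop : Continuous fun R : ℝ => 2 * exp (-R)).tendsto 0).mono_left nhdsWithin_le_nhds
  simpa using h2.mul h1

lemma tendsto_fluxRe_comp_exp {a b φ : ℂ → ℝ} (ha : ContDiffOn ℝ 2 a (ball 0 1))
    (hb : ContDiffOn ℝ 2 b (ball 0 1)) (hφ : ContDiffOn ℝ 2 φ (ball 0 1)) (R : ℝ) :
    Tendsto (fluxRe R (b 0) (fun ζ => φ (Complex.exp ζ)) (fun ζ => a (Complex.exp ζ))
      (fun ζ => b (Complex.exp ζ))) (comap Complex.re atBot) (𝓝 (fderiv ℝ φ 0 1)) := by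
  have hexp := Complex.tendsto_exp_comap_re_atBot
  have h0 : ball (0 : ℂ) 1 ∈ 𝓝 (0 : ℂ) := ball_mem_nhds 0 one_pos
  have hdφ : Tendsto (fun ζ => fderiv ℝ φ (Complex.exp ζ)) (comap Complex.re atBot)
      (𝓝 (fderiv ℝ φ 0)) :=
    ((hφ.continuousOn_fderiv_of_isOpen isOpen_ball one_le_two).continuousAt h0).tendsto.comp hexp
  have hda : Tendsto (fun ζ => fderiv ℝ a (Complex.exp ζ)) (comap Complex.re atBot)
      (𝓝 (fderiv ℝ a 0)) :=
    ((ha.continuousOn_fderiv_of_isOpen isOpen_ball one_le_two).continuousAt h0).tendsto.comp hexp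
  have hdb : Tendsto (fun ζ => b (Complex.exp ζ) - b 0) (comap Complex.re atBot) (𝓝 0) := by
    simpa using ((hb.continuousOn.continuousAt h0).tendsto.comp hexp).sub_const (b 0)
  have hP : Tendsto (fun ζ => 1 - Complex.exp ζ ^ 2 * Complex.exp (-2 * R))
      (comap Complex.re atBot) (𝓝 1) := by
    simpa using ((hexp.pow 2).mul_const (Complex.exp (-2 * R))).const_sub 1
  have hmain : Tendsto (fun ζ => fderiv ℝ φ (Complex.exp ζ)
      (1 - Complex.exp ζ ^ 2 * Complex.exp (-2 * R))) (comap Complex.re atBot)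
      (𝓝 (fderiv ℝ φ 0 1)) :=
    (isBoundedBilinearMap_apply.continuous.tendsto (fderiv ℝ φ 0, (1 : ℂ))).comp
      (hdφ.prodMk_nhds hP)
  have hre : Tendsto Complex.re (comap Complex.re atBot) atBot := tendsto_comap
  have hneg : ∀ᶠ ζ : ℂ in comap Complex.re atBot, ζ.re < 0 ∧ ζ.re ≤ R :=
    (hre.eventually_lt_atBot 0).and (hre.eventually_le_atBot R)
  have hrem : Tendsto (fun ζ => (b (Complex.exp ζ) - b 0) *
      fderiv ℝ a (Complex.exp ζ) (stripWeight R ζ • (Complex.exp ζ * Complex.I)))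
      (comap Complex.re atBot) (𝓝 0) := by
    refine squeeze_zero_norm' (a := fun ζ => ‖b (Complex.exp ζ) - b 0‖ *
      ‖fderiv ℝ a (Complex.exp ζ)‖) ?_ (by simpa using hdb.norm.mul hda.norm)
    filter_upwards [hneg] with ζ hζ
    rw [norm_mul]
    refine mul_le_mul_of_nonneg_left ?_ (norm_nonneg _)
    refine ((fderiv ℝ a (Complex.exp ζ)).le_opNorm _).trans
      (mul_le_of_le_one_right (norm_nonneg _) ?_)
    rw [norm_smul, norm_mul, Complex.norm_I, mul_one, Complex.norm_exp, stripWeight, norm_mul,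
      Real.norm_eq_abs, Real.norm_eq_abs]
    have he : exp (ζ.re - 2 * R) ≤ exp (-ζ.re) := exp_le_exp.2 (by linarith)
    have he0 := exp_pos (ζ.re - 2 * R)
    have hee : exp (-ζ.re) * exp ζ.re = 1 := by rw [← exp_add]; simp
    rw [abs_of_nonneg (by linarith), ← hee]
    refine mul_le_mul_of_nonneg_right ?_ (exp_pos _).le
    exact (mul_le_of_le_one_right (by linarith) (abs_cos_le_one _)).trans (by linarith)
  have hsum := hmain.add hrem
  rw [add_zero] at hsum
  refine hsum.congr' ?_
  filter_upwards [hneg] with ζ hζ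
  have hcomb : (1 - Complex.exp ζ ^ 2 * Complex.exp (-2 * R) : ℂ) =
      stripWeight R ζ • (Complex.exp ζ * 1) + stripConj R ζ • (Complex.exp ζ * Complex.I) := by
    have hee : exp (-ζ.re) * exp ζ.re = 1 := by rw [← exp_add]; simp
    have hR : Complex.exp (-2 * R) = (exp (-2 * R) : ℝ) := by push_cast; rfl
    have hsub : exp (ζ.re - 2 * R) = exp ζ.re * exp (-2 * R) := by
      rw [← exp_add]; ring_nf
    rw [hR]
    apply Complex.ext
    · simp [stripWeight, stripConj, Complex.exp_re, Complex.exp_im, pow_two, hsub]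
      rw [Complex.cos_ofReal_re, Complex.sin_ofReal_re]
      linear_combination (-(cos ζ.im) ^ 2 - sin ζ.im ^ 2) * hee - sin_sq_add_cos_sq ζ.im
    · simp [stripWeight, stripConj, Complex.exp_re, Complex.exp_im, pow_two, hsub]
      rw [Complex.cos_ofReal_re, Complex.sin_ofReal_re]
      ring
  rw [hcomb]
  simp only [fluxRe, fderiv_comp_exp hφ hζ.1, fderiv_comp_exp ha hζ.1, map_add, map_smul,
    smul_eq_mul]
  ring

lemma tendsto_integral_fluxRe {a b φ : ℂ → ℝ} (ha : ContDiffOn ℝ 2 a (ball 0 1))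
    (hb : ContDiffOn ℝ 2 b (ball 0 1)) (hφ : ContDiffOn ℝ 2 φ (ball 0 1))
    (heq : ∀ y ∈ ball (0 : ℂ) 1,
      fderiv ℝ (fderiv ℝ φ) y 1 1 + fderiv ℝ (fderiv ℝ φ) y Complex.I Complex.I =
      fderiv ℝ a y 1 * fderiv ℝ b y Complex.I - fderiv ℝ a y Complex.I * fderiv ℝ b y 1) (R : ℝ) :
    Tendsto (fun s : ℝ => ∫ θ in -π..π, fluxRe R (b 0) (fun ζ => φ (Complex.exp ζ))
      (fun ζ => a (Complex.exp ζ)) (fun ζ => b (Complex.exp ζ)) (s + θ * Complex.I)) atBot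
      (𝓝 (2 * π * fderiv ℝ φ 0 1)) := by
  set F := fluxRe R (b 0) (fun ζ => φ (Complex.exp ζ))
      (fun ζ => a (Complex.exp ζ)) (fun ζ => b (Complex.exp ζ)) with hF
  have hFt : Tendsto F (comap Complex.re atBot) (𝓝 (fderiv ℝ φ 0 1)) :=
    tendsto_fluxRe_comp_exp ha hb hφ R
  have hFc : ∀ ζ : ℂ, ζ.re < 0 → ContinuousAt F ζ := fun ζ hζ =>
    (exists_hasFDerivAt_flux isOpen_re_neg (contDiffOn_comp_exp hφ) (contDiffOn_comp_exp ha)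
      (contDiffOn_comp_exp hb) hζ (laplacian_comp_exp ha hb hφ heq hζ) R (b 0)).1.continuousAt
  have hint : ∫ _ in -π..π, fderiv ℝ φ 0 1 = 2 * π * fderiv ℝ φ 0 1 := by
    rw [intervalIntegral.integral_const, smul_eq_mul]
    ring
  rw [← hint]
  refine intervalIntegral.tendsto_integral_filter_of_dominated_convergence
    (fun _ => ‖fderiv ℝ φ 0 1‖ + 1) ?_ ?_ intervalIntegrable_const ?_
  · filter_upwards [eventually_lt_atBot 0] with s hs
    refine Continuous.aestronglyMeasurable (continuous_iff_continuousAt.2 fun θ => ?_)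
    exact ContinuousAt.comp (f := fun θ : ℝ => (s + θ * Complex.I : ℂ))
      (hFc _ (by simpa using hs)) (by fun_prop)
  · have h1 : ∀ᶠ ζ in comap Complex.re atBot, ‖F ζ‖ ≤ ‖fderiv ℝ φ 0 1‖ + 1 :=
      hFt.norm.eventually_le_const (lt_add_one _)
    rw [eventually_comap] at h1
    filter_upwards [h1] with s hs
    exact ae_of_all _ fun θ _ => hs _ (by simp)
  · refine ae_of_all _ fun θ _ => hFt.comp (tendsto_comap_iff.2 ?_)
    refine tendsto_id.congr fun s => ?_
    simp

lemma enorm_fderiv_centre_le {a b φ : ℂ → ℝ} (ha : ContDiffOn ℝ 2 a (ball 0 1))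
    (hb : ContDiffOn ℝ 2 b (ball 0 1)) (hφ : ContDiffOn ℝ 2 φ (ball 0 1))
    (hφc : ContinuousOn φ (closedBall 0 1)) (hφ0 : ∀ y ∈ sphere (0 : ℂ) 1, φ y = 0)
    (heq : ∀ y ∈ ball (0 : ℂ) 1,
      fderiv ℝ (fderiv ℝ φ) y 1 1 + fderiv ℝ (fderiv ℝ φ) y Complex.I Complex.I =
      fderiv ℝ a y 1 * fderiv ℝ b y Complex.I - fderiv ℝ a y Complex.I * fderiv ℝ b y 1) :
    ‖fderiv ℝ φ 0 1‖ₑ ≤ ∫⁻ y in ball (0 : ℂ) 1, ‖fderiv ℝ a y‖ₑ * ‖b y - b 0‖ₑ / ‖y‖ₑ ^ 2 := by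
  set T := ∫⁻ y in ball (0 : ℂ) 1, ‖fderiv ℝ a y‖ₑ * ‖b y - b 0‖ₑ / ‖y‖ₑ ^ 2
  set X : ℝ → ℝ := fun R =>
    2 * exp (-R) * ∫ θ in -π..π, cos θ * φ (Complex.exp (R + θ * Complex.I)) with hX
  have h1 : ∀ R < 0, ‖X R - 2 * π * fderiv ℝ φ 0 1‖ₑ ≤ 3 * T := by
    intro R hR
    refine le_of_tendsto (((tendsto_integral_fluxRe ha hb hφ heq R).const_sub (X R)).enorm) ?_
    filter_upwards [eventually_le_atBot R] with s hs
    rw [hX]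
    dsimp only
    rw [← integral_fluxRe_edge (a := a) (b := b) hφ hR (b 0),
      flux_identity isOpen_re_neg (contDiffOn_comp_exp hφ) (contDiffOn_comp_exp ha)
        (contDiffOn_comp_exp hb) (fun ζ hζ => laplacian_comp_exp ha hb hφ heq hζ)
        (fun ζ => by rw [Complex.exp_periodic]) (fun ζ => by rw [Complex.exp_periodic])
        (fun ζ => by rw [Complex.exp_periodic]) hs (fun ζ hζ => hζ.trans_lt hR)]
    exact enorm_integral_fluxDiv_le ha hb hs hR (b 0)
  have h2 : ‖0 - 2 * π * fderiv ℝ φ 0 1‖ₑ ≤ 3 * T := by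
    refine le_of_tendsto ((tendsto_integral_edge hφc hφ0).sub_const _).enorm ?_
    filter_upwards [self_mem_nhdsWithin] with R hR using h1 R hR
  have h3 : 3 * ‖fderiv ℝ φ 0 1‖ₑ ≤ ‖0 - 2 * π * fderiv ℝ φ 0 1‖ₑ := by
    rw [zero_sub, enorm_neg, enorm_mul]
    gcongr
    rw [Real.enorm_eq_ofReal (by positivity), ← ENNReal.ofReal_ofNat 3]
    exact ENNReal.ofReal_le_ofReal (by linarith [pi_gt_three])
  exact (ENNReal.mul_le_mul_iff_right (by norm_num) (by norm_num)).1 (h3.trans h2)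

end Centre

/-! ### Transfer to an arbitrary point of a disc -/

section Mobius

/-- The Möbius transformation from the unit disc onto the disc of radius `r` sending `0`
to `r * w`. -/
def discMap (r : ℝ) (κ w y : ℂ) : ℂ :=
  r * (κ * y + w) / (1 + starRingEnd ℂ w * κ * y)

variable {r : ℝ} {κ w y : ℂ}

lemma one_add_conj_mul_ne_zero (hκ : ‖κ‖ = 1) (hw : ‖w‖ < 1) (hy : ‖y‖ ≤ 1) :
    1 + starRingEnd ℂ w * κ * y ≠ 0 := by
  intro h
  have h1 : starRingEnd ℂ w * κ * y = -1 := by linear_combination h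
  have h2 : ‖starRingEnd ℂ w * κ * y‖ = 1 := by rw [h1]; simp
  rw [norm_mul, norm_mul, hκ, mul_one, RCLike.norm_conj] at h2
  nlinarith [norm_nonneg w, norm_nonneg y]

lemma normSq_one_add_conj_mul_sub (hκ : ‖κ‖ = 1) :
    ‖1 + starRingEnd ℂ w * κ * y‖ ^ 2 - ‖κ * y + w‖ ^ 2 = (1 - ‖w‖ ^ 2) * (1 - ‖y‖ ^ 2) := by
  have hκy : ‖y‖ ^ 2 = ‖κ * y‖ ^ 2 := by rw [norm_mul, hκ, one_mul]
  rw [hκy, mul_assoc]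
  generalize κ * y = z
  simp only [Complex.sq_norm, Complex.normSq_apply]
  simp
  ring

lemma norm_discMap (hr : 0 < r) :
    ‖discMap r κ w y‖ = r * (‖κ * y + w‖ / ‖1 + starRingEnd ℂ w * κ * y‖) := by
  rw [discMap, norm_div, norm_mul, Complex.norm_of_nonneg hr.le, mul_div_assoc]

lemma norm_discMap_lt (hr : 0 < r) (hκ : ‖κ‖ = 1) (hw : ‖w‖ < 1) (hy : ‖y‖ < 1) :
    ‖discMap r κ w y‖ < r := by
  have h0 := norm_pos_iff.2 (one_add_conj_mul_ne_zero hκ hw hy.le)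
  have h1 := normSq_one_add_conj_mul_sub (w := w) (y := y) hκ
  have h2 : 0 < (1 - ‖w‖ ^ 2) * (1 - ‖y‖ ^ 2) :=
    mul_pos (by nlinarith [norm_nonneg w]) (by nlinarith [norm_nonneg y])
  rw [norm_discMap hr]
  refine mul_lt_of_lt_one_right hr ((div_lt_one h0).2 ?_)
  exact lt_of_pow_lt_pow_left₀ 2 h0.le (by linarith)

lemma norm_discMap_eq (hr : 0 < r) (hκ : ‖κ‖ = 1) (hw : ‖w‖ < 1) (hy : ‖y‖ = 1) :
    ‖discMap r κ w y‖ = r := by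
  have h0 := norm_pos_iff.2 (one_add_conj_mul_ne_zero hκ hw hy.le)
  have h1 := normSq_one_add_conj_mul_sub (w := w) (y := y) hκ
  rw [hy, one_pow, sub_self, mul_zero, sub_eq_zero] at h1
  rw [norm_discMap hr, ← (pow_left_inj₀ h0.le (norm_nonneg _) two_ne_zero).1 h1,
    div_self h0.ne', mul_one]

lemma hasDerivAt_discMap (hκ : ‖κ‖ = 1) (hw : ‖w‖ < 1) (hy : ‖y‖ ≤ 1) :
    HasDerivAt (discMap r κ w)
      (r * κ * (1 - ‖w‖ ^ 2 : ℝ) / (1 + starRingEnd ℂ w * κ * y) ^ 2) y := by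
  have h0 := one_add_conj_mul_ne_zero hκ hw hy
  have h1 : HasDerivAt (fun y => (r : ℂ) * (κ * y + w)) (r * (κ * 1)) y :=
    (((hasDerivAt_id y).const_mul κ).add_const w).const_mul (r : ℂ)
  have h2 : HasDerivAt (fun y => 1 + starRingEnd ℂ w * κ * y) (starRingEnd ℂ w * κ * 1) y :=
    ((hasDerivAt_id y).const_mul _).const_add 1
  refine (h1.div h2 h0).congr_deriv ?_
  congr 1
  have := Complex.conj_mul' w
  push_cast
  rw [← this]
  ring

lemma norm_deriv_discMap (hr : 0 < r) (hκ : ‖κ‖ = 1) (hw : ‖w‖ < 1) (hy : ‖y‖ ≤ 1) :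
    ‖deriv (discMap r κ w) y‖ = r * (1 - ‖w‖ ^ 2) / ‖1 + starRingEnd ℂ w * κ * y‖ ^ 2 := by
  have hw2 : 0 ≤ 1 - ‖w‖ ^ 2 := by nlinarith [norm_nonneg w]
  rw [(hasDerivAt_discMap hκ hw hy).deriv, norm_div, norm_mul, norm_mul, hκ, norm_pow,
    Complex.norm_of_nonneg hr.le, Complex.norm_of_nonneg hw2, mul_one]

lemma discMap_sub_zero (hκ : ‖κ‖ = 1) (hw : ‖w‖ < 1) (hy : ‖y‖ ≤ 1) :
    discMap r κ w y - discMap r κ w 0 =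
      r * κ * (1 - ‖w‖ ^ 2 : ℝ) * y / (1 + starRingEnd ℂ w * κ * y) := by
  have h0 := one_add_conj_mul_ne_zero hκ hw hy
  have := Complex.conj_mul' w
  push_cast
  have hz : discMap r κ w 0 = r * w := by simp [discMap]
  rw [← this, hz, eq_div_iff h0, discMap, sub_mul, div_mul_cancel₀ _ h0]
  ring

lemma norm_discMap_sub_zero_sq (hr : 0 < r) (hκ : ‖κ‖ = 1) (hw : ‖w‖ < 1) (hy : ‖y‖ ≤ 1) :
    ‖discMap r κ w y - discMap r κ w 0‖ ^ 2 =
      ‖y‖ ^ 2 * (r * (1 - ‖w‖ ^ 2) * ‖deriv (discMap r κ w) y‖) := by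
  have hw2 : 0 ≤ 1 - ‖w‖ ^ 2 := by nlinarith [norm_nonneg w]
  rw [discMap_sub_zero hκ hw hy, norm_deriv_discMap hr hκ hw hy, norm_div, norm_mul, norm_mul,
    norm_mul, hκ, Complex.norm_of_nonneg hr.le, Complex.norm_of_nonneg hw2]
  ring

lemma injOn_discMap (hr : 0 < r) (hκ : ‖κ‖ = 1) (hw : ‖w‖ < 1) :
    Set.InjOn (discMap r κ w) (ball 0 1) := by
  intro y hy z hz h
  rw [mem_ball_zero_iff] at hy hz
  have hy0 := one_add_conj_mul_ne_zero hκ hw hy.le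
  have hz0 := one_add_conj_mul_ne_zero hκ hw hz.le
  have hr0 : (r : ℂ) ≠ 0 := by exact_mod_cast hr.ne'
  have hκ0 : κ ≠ 0 := norm_ne_zero_iff.1 (by rw [hκ]; exact one_ne_zero)
  have hw2 : ((1 - ‖w‖ ^ 2 : ℝ) : ℂ) ≠ 0 := by
    exact_mod_cast (by nlinarith [norm_nonneg w] : (0 : ℝ) < 1 - ‖w‖ ^ 2).ne'
  rw [discMap, discMap, div_eq_div_iff hy0 hz0] at h
  have hww := Complex.conj_mul' w
  push_cast at hw2
  rw [← hww] at hw2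
  have : (r : ℂ) * κ * (1 - starRingEnd ℂ w * w) * (y - z) = 0 := by linear_combination h
  simpa [hr0, hκ0, hw2, sub_eq_zero] using this

end Mobius

/-- The isometry between the complex plane and the Euclidean plane. -/
def planeIsometry : ℂ ≃ₗᵢ[ℝ] E2 := Complex.orthonormalBasisOneI.repr

lemma planeIsometry_one : planeIsometry 1 = EuclideanSpace.single 0 1 := by
  have := Complex.orthonormalBasisOneI.repr_self 0
  simpa [planeIsometry] using this

lemma planeIsometry_I : planeIsometry Complex.I = EuclideanSpace.single 1 1 := by
  have := Complex.orthonormalBasisOneI.repr_self 1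
  simpa [planeIsometry] using this

lemma setLIntegral_comp_planeIsometry (c : E2) (r : ℝ) (P : E2 → ℝ≥0∞) :
    ∫⁻ ζ in ball (0 : ℂ) r, P (c + planeIsometry ζ) = ∫⁻ z in ball c r, P z := by
  have hmp : MeasurePreserving (fun ζ => c + planeIsometry ζ) (volume : Measure ℂ) volume :=
    (measurePreserving_add_left volume c).comp planeIsometry.measurePreserving
  have hemb : MeasurableEmbedding fun ζ => c + planeIsometry ζ :=
    (measurableEmbedding_addLeft c).comp planeIsometry.toHomeomorph.measurableEmbedding
  have hpre : (fun ζ => c + planeIsometry ζ) ⁻¹' ball c r = ball 0 r := by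
    ext ζ
    simp [dist_eq_norm]
  rw [← hmp.setLIntegral_comp_preimage_emb hemb P, hpre]

lemma pd_pd_eq {D : Set E2} (hD : IsOpen D) {φ : E2 → ℝ} (hφ : ContDiffOn ℝ 2 φ D) {x : E2}
    (hx : x ∈ D) (i : Fin 2) :
    pd i (pd i φ) x =
      fderiv ℝ (fderiv ℝ φ) x (EuclideanSpace.single i 1) (EuclideanSpace.single i 1) := by
  have h : DifferentiableAt ℝ (fderiv ℝ φ) x :=
    ((hφ.fderiv_of_isOpen hD (m := 1) (by norm_num)).differentiableOn
      one_ne_zero).differentiableAt (hD.mem_nhds hx)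
  have h2 := h.hasFDerivAt.clm_apply (hasFDerivAt_const (EuclideanSpace.single i (1 : ℝ)) x)
  rw [show pd i φ = fun z => fderiv ℝ φ z (EuclideanSpace.single i 1) from rfl, pd, h2.fderiv]
  simp

section Disc

variable {c : E2} {r : ℝ} {a b φ : E2 → ℝ}

lemma enorm_fderiv_apply_le_lintegral (hr : 0 < r) (ha : ContDiffOn ℝ 2 a (ball c r))
    (hb : ContDiffOn ℝ 2 b (ball c r)) (hφ : ContDiffOn ℝ 2 φ (ball c r))
    (hφc : ContinuousOn φ (closedBall c r))
    (heq : ∀ x ∈ ball c r, lap φ x = pd 0 a x * pd 1 b x - pd 1 a x * pd 0 b x)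
    (hφ0 : ∀ x ∈ sphere c r, φ x = 0) {w κ : ℂ} (hw : ‖w‖ < 1) (hκ : ‖κ‖ = 1) :
    ‖fderiv ℝ φ (c + planeIsometry (r * w)) (planeIsometry κ)‖ₑ ≤
      ∫⁻ z in ball c r, ‖fderiv ℝ a z‖ₑ * ‖b z - b (c + planeIsometry (r * w))‖ₑ /
        ‖z - (c + planeIsometry (r * w))‖ₑ ^ 2 := by
  set x := c + planeIsometry (r * w) with hx
  set P : E2 → ℝ≥0∞ := fun z => ‖fderiv ℝ a z‖ₑ * ‖b z - b x‖ₑ / ‖z - x‖ₑ ^ 2 with hP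
  set ι : ℂ →L[ℝ] E2 := (planeIsometry : ℂ →L[ℝ] E2) with hι
  set m := discMap r κ w with hm
  have hιa : ∀ z, ι z = planeIsometry z := fun z => rfl
  have hw2 : 0 < 1 - ‖w‖ ^ 2 := by nlinarith [norm_nonneg w]
  have hmd : DifferentiableOn ℂ m (ball 0 1) := fun y hy =>
    (hasDerivAt_discMap hκ hw
      (mem_ball_zero_iff.1 hy).le).differentiableAt.differentiableWithinAt
  have hm0 : m 0 = r * w := by simp [hm, discMap]
  have hmap : ∀ y ∈ ball (0 : ℂ) 1, c + ι (m y) ∈ ball c r := by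
    intro y hy
    rw [mem_ball_iff_norm, add_sub_cancel_left, hιa, planeIsometry.norm_map]
    exact norm_discMap_lt hr hκ hw (mem_ball_zero_iff.1 hy)
  have hsph : ∀ y ∈ sphere (0 : ℂ) 1, c + ι (m y) ∈ sphere c r := by
    intro y hy
    rw [mem_sphere_iff_norm, add_sub_cancel_left, hιa, planeIsometry.norm_map]
    exact norm_discMap_eq hr hκ hw (mem_sphere_zero_iff_norm.1 hy)
  have hcl : Set.MapsTo (fun y => c + ι (m y)) (closedBall 0 1) (closedBall c r) := by
    intro y hy
    rw [← ball_union_sphere] at hy ⊢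
    exact hy.imp (hmap y) (hsph y)
  have hmc : ContinuousOn m (closedBall 0 1) := fun y hy =>
    (hasDerivAt_discMap hκ hw (mem_closedBall_zero_iff.1 hy)).continuousAt.continuousWithinAt
  have hcentre := enorm_fderiv_centre_le
    (contDiffOn_comp_holomorphic isOpen_ball hmd ha hmap)
    (contDiffOn_comp_holomorphic isOpen_ball hmd hb hmap)
    (contDiffOn_comp_holomorphic isOpen_ball hmd hφ hmap)
    (hφc.comp (continuousOn_const.add (ι.continuous.comp_continuousOn hmc)) hcl)
    (fun y hy => hφ0 _ (hsph y hy))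
    (fun y hy => by
      rw [laplacian_comp_holomorphic isOpen_ball hmd isOpen_ball hφ hmap hy,
        jacobian_comp_holomorphic isOpen_ball hmd isOpen_ball ha hb hmap hy]
      have := heq _ (hmap y hy)
      rw [lap, pd_pd_eq isOpen_ball hφ (hmap y hy), pd_pd_eq isOpen_ball hφ (hmap y hy)] at this
      simp only [hιa, planeIsometry_one, planeIsometry_I] at this ⊢
      rw [this]
      rfl)
  have h01 : (0 : ℂ) ∈ ball (0 : ℂ) 1 := mem_ball_self one_pos
  have hx0 : c + ι (m 0) = x := by rw [hm0, hx, hιa]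
  set L := ENNReal.ofReal (r * (1 - ‖w‖ ^ 2)) with hL
  have hL0 : L ≠ 0 := by
    rw [hL, Ne, ENNReal.ofReal_eq_zero, not_le]
    positivity
  have hleft : ‖fderiv ℝ (fun y => φ (c + ι (m y))) 0 1‖ₑ =
      L * ‖fderiv ℝ φ x (planeIsometry κ)‖ₑ := by
    rw [fderiv_comp_holomorphic isOpen_ball hmd isOpen_ball hφ hmap h01, hx0,
      (hasDerivAt_discMap hκ hw (by simp)).deriv]
    have : (r * κ * (1 - ‖w‖ ^ 2 : ℝ) / (1 + starRingEnd ℂ w * κ * 0) ^ 2 * 1 : ℂ) =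
        (r * (1 - ‖w‖ ^ 2)) • κ := by
      rw [Complex.real_smul]
      push_cast
      ring
    rw [this, map_smul, map_smul, enorm_smul, Real.enorm_eq_ofReal (by positivity)]
    rfl
  have hpt : ∀ y ∈ ball (0 : ℂ) 1, ‖fderiv ℝ (fun y => a (c + ι (m y))) y‖ₑ *
      ‖b (c + ι (m y)) - b (c + ι (m 0))‖ₑ / ‖y‖ₑ ^ 2 ≤
      L * (‖deriv m y‖ₑ ^ 2 * P (c + planeIsometry (m y))) := by
    intro y hy
    have hy1 := (mem_ball_zero_iff.1 hy).le
    rcases eq_or_ne y 0 with rfl | hy0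
    · simp
    have hfd : ‖fderiv ℝ (fun y => a (c + ι (m y))) y‖ₑ ≤
        ‖fderiv ℝ a (c + ι (m y))‖ₑ * ‖deriv m y‖ₑ := by
      rw [← ofReal_norm, ← ofReal_norm, ← ofReal_norm, ← ENNReal.ofReal_mul (norm_nonneg _)]
      refine ENNReal.ofReal_le_ofReal
        (ContinuousLinearMap.opNorm_le_bound _ (by positivity) fun v => ?_)
      rw [fderiv_comp_holomorphic isOpen_ball hmd isOpen_ball ha hmap hy, mul_assoc, ← norm_mul]
      refine (ContinuousLinearMap.le_opNorm _ _).trans_eq ?_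
      rw [hιa (_ * _), planeIsometry.norm_map]
    have hsub : c + ι (m y) - x = planeIsometry (m y - m 0) := by
      rw [map_sub, ← hιa, ← hιa, ← hx0]
      abel
    have hsq : ‖c + ι (m y) - x‖ₑ ^ 2 = ‖y‖ₑ ^ 2 * (L * ‖deriv m y‖ₑ) := by
      rw [hsub, ← ofReal_norm, planeIsometry.norm_map, ← ENNReal.ofReal_pow (norm_nonneg _),
        norm_discMap_sub_zero_sq hr hκ hw hy1, ENNReal.ofReal_mul (by positivity),
        ENNReal.ofReal_mul (by positivity), ENNReal.ofReal_pow (norm_nonneg _), ofReal_norm,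
        ofReal_norm]
    have hd0 : ‖deriv m y‖ₑ ≠ 0 := by
      rw [enorm_ne_zero, ← norm_ne_zero_iff, norm_deriv_discMap hr hκ hw hy1]
      have := norm_pos_iff.2 (one_add_conj_mul_ne_zero hκ hw hy1)
      positivity
    have hdt : ‖deriv m y‖ₑ ≠ ⊤ := enorm_ne_top
    have hyn0 : ‖y‖ₑ ^ 2 ≠ 0 := by simpa using hy0
    have hynt : ‖y‖ₑ ^ 2 ≠ ⊤ := by simp
    rw [hP, hx0, ← hιa]
    dsimp only
    rw [hsq]
    generalize ‖y‖ₑ ^ 2 = t at *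
    generalize ‖deriv m y‖ₑ = d at *
    have hLt : L ≠ ⊤ := ENNReal.ofReal_ne_top
    calc _ ≤ ‖fderiv ℝ a (c + ι (m y))‖ₑ * d * ‖b (c + ι (m y)) - b x‖ₑ / t := by gcongr
      _ = (L * L⁻¹) * (d * d⁻¹) *
          (‖fderiv ℝ a (c + ι (m y))‖ₑ * d * ‖b (c + ι (m y)) - b x‖ₑ / t) := by
          rw [ENNReal.mul_inv_cancel hL0 hLt, ENNReal.mul_inv_cancel hd0 hdt, one_mul, one_mul]
      _ = _ := by
          rw [div_eq_mul_inv, div_eq_mul_inv, ENNReal.mul_inv (Or.inl hyn0) (Or.inl hynt),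
            ENNReal.mul_inv (Or.inl hL0) (Or.inl hLt)]
          ring
  have himg : m '' ball 0 1 ⊆ ball 0 r := by
    rintro _ ⟨y, hy, rfl⟩
    exact mem_ball_zero_iff.2 (norm_discMap_lt hr hκ hw (mem_ball_zero_iff.1 hy))
  refine (ENNReal.mul_le_mul_iff_right hL0 ENNReal.ofReal_ne_top).1 ?_
  calc _ ≤ _ := hleft.symm.le.trans hcentre
    _ ≤ ∫⁻ y in ball (0 : ℂ) 1, L * (‖deriv m y‖ₑ ^ 2 * P (c + planeIsometry (m y))) :=
        setLIntegral_mono' measurableSet_ball hpt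
    _ = L * ∫⁻ y in m '' ball 0 1, P (c + planeIsometry y) := by
        rw [lintegral_const_mul' _ _ ENNReal.ofReal_ne_top,
          setLIntegral_image_holomorphic isOpen_ball hmd measurableSet_ball subset_rfl
            (injOn_discMap hr hκ hw) fun y => P (c + planeIsometry y)]
    _ ≤ L * ∫⁻ y in ball 0 r, P (c + planeIsometry y) := by gcongr
    _ = _ := by rw [setLIntegral_comp_planeIsometry]

lemma enorm_fderiv_le_lintegral (hr : 0 < r) (ha : ContDiffOn ℝ 2 a (ball c r))
    (hb : ContDiffOn ℝ 2 b (ball c r)) (hφ : ContDiffOn ℝ 2 φ (ball c r))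
    (hφc : ContinuousOn φ (closedBall c r))
    (heq : ∀ x ∈ ball c r, lap φ x = pd 0 a x * pd 1 b x - pd 1 a x * pd 0 b x)
    (hφ0 : ∀ x ∈ sphere c r, φ x = 0) {x : E2} (hx : x ∈ ball c r) :
    ‖fderiv ℝ φ x‖ₑ ≤
      ∫⁻ z in ball c r, ‖fderiv ℝ a z‖ₑ * ‖b z - b x‖ₑ / ‖z - x‖ₑ ^ 2 := by
  set T := ∫⁻ z in ball c r, ‖fderiv ℝ a z‖ₑ * ‖b z - b x‖ₑ / ‖z - x‖ₑ ^ 2 with hT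
  rcases eq_or_ne T ⊤ with hTt | hTt
  · simp [hTt]
  have hr0 : (r : ℂ) ≠ 0 := by exact_mod_cast hr.ne'
  set w : ℂ := planeIsometry.symm (x - c) / r with hwdef
  have hw : ‖w‖ < 1 := by
    rw [hwdef, norm_div, planeIsometry.symm.norm_map, Complex.norm_of_nonneg hr.le, div_lt_one hr]
    exact mem_ball_iff_norm.1 hx
  have hxw : c + planeIsometry (r * w) = x := by
    rw [hwdef, mul_div_cancel₀ _ hr0, planeIsometry.apply_symm_apply, add_sub_cancel]
  rw [← ofReal_norm, ← ENNReal.ofReal_toReal hTt]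
  refine ENNReal.ofReal_le_ofReal
    (ContinuousLinearMap.opNorm_le_of_unit_norm ENNReal.toReal_nonneg fun v hv => ?_)
  have h := enorm_fderiv_apply_le_lintegral hr ha hb hφ hφc heq hφ0 hw
    (κ := planeIsometry.symm v) (by rw [planeIsometry.symm.norm_map, hv])
  rw [hxw, planeIsometry.apply_symm_apply, ← hT, ← ofReal_norm] at h
  exact (ENNReal.ofReal_le_iff_le_toReal hTt).1 h

end Disc

/-! ### The Lorentz estimate -/

lemma enorm_fderiv_le_rieszPot {c : E2} {r α : ℝ} {a b φ : E2 → ℝ} (hα0 : 0 < α) (hα1 : α < 1)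
    (hr : 0 < r) (ha : ContDiffOn ℝ 2 a (ball c r))
    (hb : ContDiffOn ℝ 2 b (ball c r)) (hφ : ContDiffOn ℝ 2 φ (ball c r))
    (hφc : ContinuousOn φ (closedBall c r))
    (heq : ∀ x ∈ ball c r, lap φ x = pd 0 a x * pd 1 b x - pd 1 a x * pd 0 b x)
    (hφ0 : ∀ x ∈ sphere c r, φ x = 0) {x : E2} (hx : x ∈ ball c r) :
    ‖fderiv ℝ φ x‖ₑ ≤ ENNReal.ofReal (16 / (1 - α)) *
      (rieszPot α ((ball c r).indicator fun z => ‖fderiv ℝ b z‖ₑ) x *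
        rieszPot (1 - α) ((ball c r).indicator fun z => ‖fderiv ℝ a z‖ₑ) x +
      rieszPot (1 - α) (fun y => (ball c r).indicator (fun z => ‖fderiv ℝ a z‖ₑ) y *
        rieszPot α ((ball c r).indicator fun z => ‖fderiv ℝ b z‖ₑ) y) x) := by
  set g : E2 → ℝ≥0∞ := (ball c r).indicator fun z => ‖fderiv ℝ b z‖ₑ with hg
  set h : E2 → ℝ≥0∞ := (ball c r).indicator fun z => ‖fderiv ℝ a z‖ₑ with hh
  set K := ENNReal.ofReal (16 / (1 - α)) with hK
  have hKt : K ≠ ⊤ := ENNReal.ofReal_ne_top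
  have hhm : Measurable h := (measurable_fderiv ℝ a).enorm.indicator measurableSet_ball
  have hker : Measurable fun y : E2 => ‖x - y‖ₑ ^ (1 - α - 2) :=
    (measurable_const.sub measurable_id).enorm.pow_const _
  have hpt : ∀ z ∈ ball c r, ‖fderiv ℝ a z‖ₑ * ‖b z - b x‖ₑ / ‖z - x‖ₑ ^ 2 ≤
      K * (rieszPot α g x * (h z * ‖x - z‖ₑ ^ (1 - α - 2)) +
        h z * rieszPot α g z * ‖x - z‖ₑ ^ (1 - α - 2)) := by
    intro z hz
    rcases eq_or_ne z x with rfl | hzx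
    · simp
    have hd0 : ‖z - x‖ₑ ≠ 0 := by simpa [sub_eq_zero] using hzx
    have hhz : h z = ‖fderiv ℝ a z‖ₑ := Set.indicator_of_mem hz _
    have hsub := enorm_sub_le_rieszPot hα0 hα1 c hr (hb.of_le one_le_two) hz hx
    have hpow : ‖x - z‖ₑ ^ (1 - α - 2) = ‖z - x‖ₑ ^ (1 - α) / ‖z - x‖ₑ ^ 2 := by
      rw [enorm_sub_rev, ENNReal.rpow_sub _ _ hd0 enorm_ne_top, ENNReal.rpow_two]
    rw [hpow, hhz]
    calc _ ≤ ‖fderiv ℝ a z‖ₑ * (K * ‖z - x‖ₑ ^ (1 - α) *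
          (rieszPot α g z + rieszPot α g x)) / ‖z - x‖ₑ ^ 2 := by gcongr
      _ = _ := by
        simp only [div_eq_mul_inv]
        ring
  calc _ ≤ _ := enorm_fderiv_le_lintegral hr ha hb hφ hφc heq hφ0 hx
    _ ≤ ∫⁻ z in ball c r, K * (rieszPot α g x * (h z * ‖x - z‖ₑ ^ (1 - α - 2)) +
        h z * rieszPot α g z * ‖x - z‖ₑ ^ (1 - α - 2)) := setLIntegral_mono' measurableSet_ball hpt
    _ ≤ ∫⁻ z, K * (rieszPot α g x * (h z * ‖x - z‖ₑ ^ (1 - α - 2)) +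
        h z * rieszPot α g z * ‖x - z‖ₑ ^ (1 - α - 2)) := setLIntegral_le_lintegral _ _
    _ = _ := by
      have hm : Measurable fun z => h z * ‖x - z‖ₑ ^ (1 - α - 2) := hhm.mul hker
      rw [lintegral_const_mul' _ _ hKt, lintegral_add_left (hm.const_mul _),
        lintegral_const_mul _ hm]
      rfl

lemma one_le_and_inv_le_of_inv_eq {q qs : ℝ≥0∞} (hq : 2 ≤ q) (hqs : 1 / qs = 1 / 2 + 1 / q) :
    1 ≤ qs ∧ 1 / q.toReal ≤ 1 / qs.toReal := by
  simp only [one_div] at hqs ⊢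
  have hqi : q⁻¹ ≤ 2⁻¹ := ENNReal.inv_le_inv.2 hq
  have hsum : qs⁻¹ ≤ 1 := by
    rw [hqs, ← ENNReal.inv_two_add_inv_two]
    gcongr
  refine ⟨ENNReal.inv_le_one.1 hsum, ?_⟩
  rw [← ENNReal.toReal_inv, ← ENNReal.toReal_inv]
  refine ENNReal.toReal_mono (ne_top_of_le_ne_top ENNReal.one_ne_top hsum) ?_
  rw [hqs]
  exact le_add_self

/-- Lorentz-space Wente estimate: if `Δφ = ∇^⊥a·∇b` with `∇a ∈ L²` and
`∇b ∈ L^{p,q}`, then `‖∇φ‖_{L^{p,q*}} ≤ C_p ‖∇a‖_{L²} ‖∇b‖_{L^{p,q}}` where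
`1/q* = 1/2 + 1/q`, with `C_p` uniform on compact subintervals of `(1,∞)`. -/
theorem wente_lorentz (p₀ p₁ : ℝ) (hp₀ : 1 < p₀) (hp₁ : p₀ ≤ p₁) :
    ∃ C > (0:ℝ), ∀ p ∈ Set.Icc p₀ p₁, ∀ q : ℝ≥0∞, 2 ≤ q →
      ∀ qs : ℝ≥0∞, 1 / qs = 1 / 2 + 1 / q →
      ∀ (c : E2) (r : ℝ), 0 < r → ∀ a b φ : E2 → ℝ,
      ContDiffOn ℝ (⊤ : ℕ∞) a (ball c r) → ContDiffOn ℝ (⊤ : ℕ∞) b (ball c r) →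
      ContDiffOn ℝ (⊤ : ℕ∞) φ (ball c r) → ContinuousOn φ (closedBall c r) →
      IntegrableOn (fun x => ‖fderiv ℝ a x‖ ^ 2) (ball c r) →
      lorentzNorm p q (fun x => ‖fderiv ℝ b x‖) (ball c r) ≠ ⊤ →
      (∀ x ∈ ball c r, lap φ x = pd 0 a x * pd 1 b x - pd 1 a x * pd 0 b x) →
      (∀ x ∈ sphere c r, φ x = 0) →
      lorentzNorm p qs (fun x => ‖fderiv ℝ φ x‖) (ball c r) ≤
        ENNReal.ofReal (C * (∫ x in ball c r, ‖fderiv ℝ a x‖ ^ 2) ^ ((1:ℝ) / 2)) *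
          lorentzNorm p q (fun x => ‖fderiv ℝ b x‖) (ball c r) := by
  set M : ℝ := p₁ + p₁ / (p₀ - 1) with hM
  have hp₀' : 0 < p₀ - 1 := by linarith
  have hp₁0 : 0 < p₁ := by linarith
  have hM0 : 0 < M := by positivity
  refine ⟨16 * M * (128 * (2 * π * M + 1) ^ 2 * M ^ 2), by positivity, ?_⟩
  intro p hp q hq qs hqs c r hr a b φ ha hb hφ hφc hint _ heq hφ0
  have h2 : (2 : WithTop ℕ∞) ≤ ((⊤ : ℕ∞) : WithTop ℕ∞) :=
    WithTop.coe_le_coe.2 (le_top : (2 : ℕ∞) ≤ ⊤)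
  have hp1 : 1 < p := hp₀.trans_le hp.1
  have hp0 : 0 < p := by linarith
  have hpM : p ≤ M := hp.2.trans (le_add_of_nonneg_right (by positivity))
  have hpM' : p / (p - 1) ≤ M := by
    have : p / (p - 1) ≤ p₁ / (p₀ - 1) := div_le_div₀ hp₁0.le hp.2 hp₀' (by linarith [hp.1])
    linarith
  obtain ⟨hqs1, hqq⟩ := one_le_and_inv_le_of_inv_eq hq hqs
  have hα1 : 1 / p < 1 := (div_lt_one hp0).2 hp1
  set D := ball c r with hD
  have hDm : MeasurableSet D := measurableSet_ball
  set K := ENNReal.ofReal (16 / (1 - 1 / p)) with hK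
  have hKM : K ≤ ENNReal.ofReal (16 * M) := by
    refine ENNReal.ofReal_le_ofReal ?_
    have : 16 / (1 - 1 / p) = 16 * (p / (p - 1)) := by
      have : p - 1 ≠ 0 := by linarith
      field_simp
    rw [this]
    linarith
  have hmain := dilationNorm_rearr_bilinear_le hp1 hpM hpM' hq hqs hqs1
    (K := K) ENNReal.ofReal_ne_top
    (g := D.indicator fun z => ‖fderiv ℝ b z‖ₑ) (h := D.indicator fun z => ‖fderiv ℝ a z‖ₑ)
    (u := D.indicator fun z => ‖fderiv ℝ φ z‖ₑ)
    ((measurable_fderiv ℝ b).enorm.indicator hDm)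
    ((measurable_fderiv ℝ a).enorm.indicator hDm) (fun x => by
      by_cases hx : x ∈ D
      · rw [Set.indicator_of_mem hx]
        exact enorm_fderiv_le_rieszPot (by positivity) hα1 hr (ha.of_le h2) (hb.of_le h2)
          (hφ.of_le h2) hφc heq hφ0 hx
      · rw [Set.indicator_of_notMem hx]
        exact zero_le)
  have hLtwo : dilationNorm 2 (fun m => ENNReal.ofReal m ^ (1 / 2 : ℝ) *
      rearr volume (D.indicator fun z => ‖fderiv ℝ a z‖ₑ) m) =
      ENNReal.ofReal ((∫ x in D, ‖fderiv ℝ a x‖ ^ 2) ^ ((1:ℝ) / 2)) := by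
    have hind : (D.indicator fun z => ‖fderiv ℝ a z‖ₑ) =
        fun z => ENNReal.ofReal (D.indicator (fun z => ‖fderiv ℝ a z‖) z) := by
      ext z
      by_cases hz : z ∈ D <;> simp [hz]
    rw [hind, dilationNorm_two_rearr volume
      (fun z => Set.indicator_nonneg (fun _ _ => norm_nonneg _) z)
      ((measurable_fderiv ℝ a).norm.indicator hDm),
      ← ENNReal.ofReal_rpow_of_nonneg (integral_nonneg fun _ => by positivity) (by norm_num),
      ofReal_integral_eq_lintegral_ofReal hint (Filter.Eventually.of_forall fun _ => by positivity),
      ← lintegral_indicator hDm]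
    congr 2
    ext z
    by_cases hz : z ∈ D <;> simp [hz]
  have hpow : ENNReal.ofReal p ^ (-(1 / qs.toReal)) ≤ ENNReal.ofReal p ^ (-(1 / q.toReal)) :=
    ENNReal.rpow_le_rpow_of_exponent_le (by simpa using hp1.le) (neg_le_neg hqq)
  rw [lorentzNorm_eq hp0 hqs1, lorentzNorm_eq hp0 (one_le_two.trans hq)]
  simp only [enorm_norm]
  rw [hLtwo] at hmain
  rw [ENNReal.ofReal_mul (by positivity), ENNReal.ofReal_mul (by positivity)]
  refine (mul_le_mul' hpow (hmain.trans
    (mul_le_mul' (mul_le_mul' hKM le_rfl) le_rfl))).trans_eq ?_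
  ring

end
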